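/- There exist D ∈ ℕ, a sequence of finite connected simple graphs G_n = (V_n, E_n) with maximal degree at most D and |V_n| → ∞, and for each n a partition of V_n all of whose parts are singletons or pairs, such that, denoting by t̂_n the 1/4 total variation mixing time of the chain obtained from the lazy simple random walk on G_n by lumping each part of the partition into a single state, there are constants c,C > 0 with c·log|V_n|·t_mix(G_n) ≤ t̂_n ≤ C·log|V_n|·t_mix(G_n) for all n. (In particular, lumping states together can increase the order of the total variation mixing time of a reversible chain by a factor of Θ(log|V_n|), answering a question of Aldous and Fill in the negative.) -/

import Mathlib

open Filter Finset

noncomputable section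

variable {V : Type} [Fintype V] [DecidableEq V]

/-- `P` is a row-stochastic matrix. -/
def IsStoch (P : Matrix V V ℝ) : Prop :=
  (∀ i j, 0 ≤ P i j) ∧ ∀ i, ∑ j, P i j = 1

/-- `π` is a probability vector with full support. -/
def IsProb (π : V → ℝ) : Prop := (∀ i, 0 < π i) ∧ ∑ i, π i = 1

/-- reversibility: `π x * P x y = π y * P y x`. -/
def Rev (P : Matrix V V ℝ) (π : V → ℝ) : Prop := ∀ i j, π i * P i j = π j * P j i

/-- irreducibility -/
def Irred (P : Matrix V V ℝ) : Prop := ∀ i j, ∃ t : ℕ, 0 < (P ^ t) i j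

/-- the lazy version `(I + P)/2` of a chain -/
def lazyM (P : Matrix V V ℝ) : Matrix V V ℝ := (2 : ℝ)⁻¹ • (1 + P)

/-- total variation distance -/
def tvDist (μ ν : V → ℝ) : ℝ := (∑ x, |μ x - ν x|) / 2

/-- worst-case total variation distance from stationarity at time `t` -/
def dTV (P : Matrix V V ℝ) (π : V → ℝ) (t : ℕ) : ℝ := ⨆ x, tvDist ((P ^ t) x) π

/-- the `ε` total-variation mixing time -/
def mixTime (P : Matrix V V ℝ) (π : V → ℝ) (ε : ℝ) : ℕ := sInf {t : ℕ | dTV P π t ≤ ε}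

/-- worst-case separation distance at time `t` -/
def dSep (P : Matrix V V ℝ) (π : V → ℝ) (t : ℕ) : ℝ := 1 - ⨅ x, ⨅ y, ((P ^ t) x y) / π y

/-- the `ε` separation time -/
def sepTime (P : Matrix V V ℝ) (π : V → ℝ) (ε : ℝ) : ℕ := sInf {t : ℕ | dSep P π t ≤ ε}

/-- the heat kernel `H_t = exp (t (P - I))` of the associated continuous-time chain -/
def heatKer (P : Matrix V V ℝ) (t : ℝ) : Matrix V V ℝ :=
  ∑' k : ℕ, (t ^ k / (Nat.factorial k : ℝ)) • ((P - 1) ^ k)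

/-- separation distance of the continuous-time chain -/
def dSepC (P : Matrix V V ℝ) (π : V → ℝ) (t : ℝ) : ℝ := 1 - ⨅ x, ⨅ y, (heatKer P t) x y / π y

/-- the `ε` separation time of the continuous-time chain -/
def sepTimeC (P : Matrix V V ℝ) (π : V → ℝ) (ε : ℝ) : ℝ := sInf {t : ℝ | 0 ≤ t ∧ dSepC P π t ≤ ε}

/-- degree of a vertex -/
def deg (G : SimpleGraph V) (v : V) : ℕ := Nat.card {u // G.Adj v u}

open Classical in
/-- transition matrix of the lazy simple random walk on `G` -/
def walkMat (G : SimpleGraph V) : Matrix V V ℝ :=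
  Matrix.of fun v u => if v = u then 1/2 else if G.Adj v u then 1 / (2 * (deg G v : ℝ)) else 0

/-- stationary distribution of the (lazy) simple random walk on `G` -/
def degSta (G : SimpleGraph V) (v : V) : ℝ := (deg G v : ℝ) / ∑ u, (deg G u : ℝ)

/-- the `ε` total-variation mixing time of the lazy simple random walk on `G` -/
def tmixG (G : SimpleGraph V) (ε : ℝ) : ℕ := mixTime (walkMat G) (degSta G) ε

/-- the second largest eigenvalue of a reversible transition matrix -/
def lam2 (P : Matrix V V ℝ) : ℝ :=
  sSup {μ : ℝ | μ ≠ 1 ∧ ∃ f : V → ℝ, f ≠ 0 ∧ P.mulVec f = μ • f}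

/-- the relaxation time `1/(1-λ₂)` -/
def trel (P : Matrix V V ℝ) : ℝ := 1 / (1 - lam2 P)

/-- the relaxation time of the lazy simple random walk on `G` -/
def trelG (G : SimpleGraph V) : ℝ := trel (walkMat G)

/-- transition matrix of the lazy random walk on the network with edge weights `w` -/
def wMat (w : V → V → ℝ) : Matrix V V ℝ :=
  Matrix.of fun v u => if v = u then 1/2 else w v u / (2 * ∑ x, w v x)

/-- stationary distribution of the lazy random walk on the network with edge weights `w` -/
def wSta (w : V → V → ℝ) (v : V) : ℝ := (∑ x, w v x) / ∑ u, ∑ x, w u x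

/-- `w` is a valid system of edge weights on the graph `G`: symmetric, positive on edges
and vanishing off the edges. -/
def GoodWeights (G : SimpleGraph V) (w : V → V → ℝ) : Prop :=
  (∀ u v, w u v = w v u) ∧ (∀ u v, G.Adj u v → 0 < w u v) ∧ ∀ u v, ¬ G.Adj u v → w u v = 0

/-- the `ε` total-variation mixing time of the lazy random walk on the weighted network -/
def tmixW (w : V → V → ℝ) (ε : ℝ) : ℕ := mixTime (wMat w) (wSta w) ε

/-- the probability of a discrete trajectory -/
def pathProb (P : Matrix V V ℝ) {k : ℕ} (w : Fin (k+1) → V) : ℝ :=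
  ∏ i : Fin k, P (w i.castSucc) (w i.succ)

/-- `P_x[T_y = k]`: probability that the chain started at `x` first hits `y` at time `k` -/
def firstHit (P : Matrix V V ℝ) (x y : V) (k : ℕ) : ℝ :=
  ∑ w : Fin (k+1) → V,
    if w 0 = x ∧ w (Fin.last k) = y ∧ ∀ i : Fin k, w i.castSucc ≠ y then pathProb P w else 0

/-- the restriction of `P - I` to the complement of `y` -/
def restrQ (P : Matrix V V ℝ) (y : V) : Matrix {w : V // w ≠ y} {w : V // w ≠ y} ℝ :=
  Matrix.of fun a b => P a.1 b.1 - if a = b then 1 else 0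

/-- `exp (t A)` where `A` is the restriction of `P - I` to the complement of `y` -/
def heatRestr (P : Matrix V V ℝ) (y : V) (t : ℝ) :
    Matrix {w : V // w ≠ y} {w : V // w ≠ y} ℝ :=
  ∑' k : ℕ, (t ^ k / (Nat.factorial k : ℝ)) • (restrQ P y ^ k)

/-- `P_x[T_B < r]` for the chain `P`: the probability that the set `B` is hit before time `r` -/
def hitByTime (P : Matrix V V ℝ) (B : Finset V) (x : V) (r : ℕ) : ℝ :=
  ∑ k ∈ Finset.range r, ∑ w : Fin (k+1) → V,
    if w 0 = x ∧ w (Fin.last k) ∈ B ∧ ∀ i : Fin k, w i.castSucc ∉ B then pathProb P w else 0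


/-- the transition matrix of the chain obtained from `(P, π)` by lumping together the fibers of
`p : V → Fin k`: `P̂ i j = P_π[X₁ ∈ p⁻¹(j) ∣ X₀ ∈ p⁻¹(i)]`. -/
def lumpMat {k : ℕ} (P : Matrix V V ℝ) (π : V → ℝ) (p : V → Fin k) :
    Matrix (Fin k) (Fin k) ℝ :=
  Matrix.of fun i j =>
    (∑ a, ∑ b, if p a = i ∧ p b = j then π a * P a b else 0) /
      (∑ a, if p a = i then π a else 0)

/-- the stationary distribution of the lumped chain: `π̂ i = π (p⁻¹(i))`. -/
def lumpSta {k : ℕ} (π : V → ℝ) (p : V → Fin k) : Fin k → ℝ :=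
  fun i => ∑ a, if p a = i then π a else 0

set_option linter.unusedSectionVars false
/-! ### Reversible chains in `ℓ²(π)` -/

/-- The inner product of `ℓ²(π)`. -/
def wInner (π f g : V → ℝ) : ℝ := ∑ x, π x * (f x * g x)

lemma wInner_comm (π f g : V → ℝ) : wInner π f g = wInner π g f := by
  simp only [wInner, mul_comm]

lemma wInner_self_nonneg {π : V → ℝ} (hπ : ∀ x, 0 ≤ π x) (f : V → ℝ) : 0 ≤ wInner π f f :=
  Finset.sum_nonneg fun x _ => mul_nonneg (hπ x) (mul_self_nonneg _)

lemma wInner_mulVec {P : Matrix V V ℝ} {π : V → ℝ} (hr : Rev P π) (f g : V → ℝ) :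
    wInner π f (P.mulVec g) = wInner π (P.mulVec f) g := by
  simp only [wInner, Matrix.mulVec, dotProduct, Finset.mul_sum, Finset.sum_mul]
  rw [Finset.sum_comm]
  refine Finset.sum_congr rfl fun y _ => Finset.sum_congr rfl fun x _ => ?_
  linear_combination (f x * g y) * hr x y

lemma mulVec_one {P : Matrix V V ℝ} (hP : IsStoch P) : P.mulVec (fun _ => 1) = fun _ => 1 := by
  funext x
  simp [Matrix.mulVec, dotProduct, hP.2 x]

lemma sum_mulVec {P : Matrix V V ℝ} {π : V → ℝ} (hP : IsStoch P) (hr : Rev P π) (g : V → ℝ) :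
    ∑ x, π x * (P.mulVec g) x = ∑ x, π x * g x := by
  have := wInner_mulVec hr (fun _ => 1) g
  rw [mulVec_one hP] at this
  simpa [wInner] using this

lemma pow_succ_mulVec (P : Matrix V V ℝ) (t : ℕ) (f : V → ℝ) :
    (P ^ (t + 1)).mulVec f = P.mulVec ((P ^ t).mulVec f) := by
  rw [pow_succ', Matrix.mulVec_mulVec]

lemma pow_mulVec_one {P : Matrix V V ℝ} (hP : IsStoch P) (t : ℕ) :
    (P ^ t).mulVec (fun _ => 1) = fun _ => 1 := by
  induction t with
  | zero => simp
  | succ t ih => rw [pow_succ_mulVec, ih, mulVec_one hP]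

lemma pow_add_mulVec (P : Matrix V V ℝ) (s t : ℕ) (f : V → ℝ) :
    (P ^ (s + t)).mulVec f = (P ^ s).mulVec ((P ^ t).mulVec f) := by
  rw [pow_add, Matrix.mulVec_mulVec]

lemma sum_pow_mulVec {P : Matrix V V ℝ} {π : V → ℝ} (hP : IsStoch P) (hr : Rev P π) (g : V → ℝ)
    (t : ℕ) : ∑ x, π x * ((P ^ t).mulVec g) x = ∑ x, π x * g x := by
  induction t with
  | zero => simp
  | succ t ih => rw [pow_succ_mulVec, sum_mulVec hP hr, ih]

lemma wInner_pow_mulVec {P : Matrix V V ℝ} {π : V → ℝ} (hr : Rev P π) (f g : V → ℝ) (t : ℕ) :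
    wInner π f ((P ^ t).mulVec g) = wInner π ((P ^ t).mulVec f) g := by
  induction t generalizing f with
  | zero => simp
  | succ t ih =>
    rw [pow_succ_mulVec, wInner_mulVec hr, ih, Matrix.mulVec_mulVec, ← pow_succ]

lemma mulVec_le {P : Matrix V V ℝ} (hP : IsStoch P) {f g : V → ℝ} (h : ∀ x, f x ≤ g x) (x : V) :
    (P.mulVec f) x ≤ (P.mulVec g) x :=
  Finset.sum_le_sum fun y _ => mul_le_mul_of_nonneg_left (h y) (hP.1 x y)

lemma mulVec_le_const {P : Matrix V V ℝ} (hP : IsStoch P) {f : V → ℝ} {M : ℝ}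
    (h : ∀ x, f x ≤ M) (x : V) : (P.mulVec f) x ≤ M := by
  calc (P.mulVec f) x ≤ ∑ y, P x y * M :=
        Finset.sum_le_sum fun y _ => mul_le_mul_of_nonneg_left (h y) (hP.1 x y)
    _ = M := by rw [← Finset.sum_mul, hP.2, one_mul]

lemma pow_mulVec_le_const {P : Matrix V V ℝ} (hP : IsStoch P) {f : V → ℝ} {M : ℝ}
    (h : ∀ x, f x ≤ M) (t : ℕ) (x : V) : ((P ^ t).mulVec f) x ≤ M := by
  induction t generalizing x with
  | zero => simpa using h x
  | succ t ih => rw [pow_succ_mulVec]; exact mulVec_le_const hP ih x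

lemma abs_pow_mulVec_le {P : Matrix V V ℝ} (hP : IsStoch P) {f : V → ℝ} {M : ℝ}
    (h : ∀ x, |f x| ≤ M) (t : ℕ) (x : V) : |((P ^ t).mulVec f) x| ≤ M := by
  rw [abs_le']
  refine ⟨pow_mulVec_le_const hP (fun x => (abs_le'.1 (h x)).1) t x, ?_⟩
  have := pow_mulVec_le_const hP (fun x => (abs_le'.1 (h x)).2) t x
  simpa [Matrix.mulVec_neg] using (show ((P ^ t).mulVec (-f)) x ≤ M from this)

lemma sum_sq_expand {P : Matrix V V ℝ} {π : V → ℝ} (hP : IsStoch P) (hr : Rev P π) (f : V → ℝ)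
    (s : ℝ) : ∑ x, ∑ y, π x * P x y * (f x + s * f y) ^ 2 =
      (1 + s ^ 2) * wInner π f f + 2 * s * wInner π f (P.mulVec f) := by
  have h1 : ∑ x, ∑ y, π x * P x y * f x ^ 2 = wInner π f f := by
    refine Finset.sum_congr rfl fun x _ => ?_
    rw [← Finset.sum_mul, ← Finset.mul_sum, hP.2]; ring
  have h2 : ∑ x, ∑ y, π x * P x y * f y ^ 2 = wInner π f f := by
    rw [← h1, Finset.sum_comm]
    exact Finset.sum_congr rfl fun x _ => Finset.sum_congr rfl fun y _ => by rw [hr y x]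
  have h3 : ∑ x, ∑ y, π x * P x y * (f x * f y) = wInner π f (P.mulVec f) := by
    simp only [wInner, Matrix.mulVec, dotProduct, Finset.mul_sum]
    exact Finset.sum_congr rfl fun x _ => Finset.sum_congr rfl fun y _ => by ring
  have : ∀ x y, π x * P x y * (f x + s * f y) ^ 2 = π x * P x y * f x ^ 2 +
      s ^ 2 * (π x * P x y * f y ^ 2) + 2 * s * (π x * P x y * (f x * f y)) := by
    intro x y; ring
  simp only [this, Finset.sum_add_distrib, ← Finset.mul_sum, h1, h2, h3]
  ring

/-- A chain that holds with probability at least `1/2` is a nonnegative operator. -/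
lemma wInner_mulVec_nonneg {P : Matrix V V ℝ} {π : V → ℝ} (hP : IsStoch P) (hπ : ∀ x, 0 ≤ π x)
    (hr : Rev P π) (hl : ∀ x, 1 / 2 ≤ P x x) (f : V → ℝ) : 0 ≤ wInner π f (P.mulVec f) := by
  have h1 := sum_sq_expand hP hr f 1
  have h2 : 2 * wInner π f f ≤ ∑ x, ∑ y, π x * P x y * (f x + 1 * f y) ^ 2 := by
    rw [wInner, Finset.mul_sum]
    refine Finset.sum_le_sum fun x _ => ?_
    refine le_trans ?_ (Finset.single_le_sum (f := fun y => π x * P x y * (f x + 1 * f y) ^ 2)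
      (fun y _ => mul_nonneg (mul_nonneg (hπ x) (hP.1 x y)) (sq_nonneg _)) (Finset.mem_univ x))
    have := mul_nonneg (mul_nonneg (hπ x) (sub_nonneg.2 (hl x))) (sq_nonneg (f x))
    nlinarith
  linarith

lemma wInner_mulVec_le {P : Matrix V V ℝ} {π : V → ℝ} (hP : IsStoch P) (hπ : ∀ x, 0 ≤ π x)
    (hr : Rev P π) (f : V → ℝ) : wInner π f (P.mulVec f) ≤ wInner π f f := by
  have h1 := sum_sq_expand hP hr f (-1)
  have h2 : 0 ≤ ∑ x, ∑ y, π x * P x y * (f x + -1 * f y) ^ 2 :=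
    Finset.sum_nonneg fun x _ => Finset.sum_nonneg fun y _ =>
      mul_nonneg (mul_nonneg (hπ x) (hP.1 x y)) (sq_nonneg _)
  linarith

lemma wInner_sub_smul (π f g : V → ℝ) (s : ℝ) :
    wInner π (f - s • g) (f - s • g) =
      wInner π f f - 2 * s * wInner π f g + s ^ 2 * wInner π g g := by
  simp only [wInner, Finset.mul_sum, ← Finset.sum_sub_distrib, ← Finset.sum_add_distrib]
  refine Finset.sum_congr rfl fun x _ => ?_
  simp only [Pi.sub_apply, Pi.smul_apply, smul_eq_mul]
  ring

/-- A nonnegative operator whose quadratic form is at most `l` has norm at most `l`. -/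
lemma wInner_mulVec_mulVec_le {P : Matrix V V ℝ} {π : V → ℝ} (hr : Rev P π)
    (hpos : ∀ f, 0 ≤ wInner π f (P.mulVec f)) {l : ℝ} (hl : 0 < l) {f : V → ℝ}
    (h1 : wInner π f (P.mulVec f) ≤ l * wInner π f f)
    (h2 : wInner π (P.mulVec f) (P.mulVec (P.mulVec f)) ≤
      l * wInner π (P.mulVec f) (P.mulVec f)) :
    wInner π (P.mulVec f) (P.mulVec f) ≤ l ^ 2 * wInner π f f := by
  set g := P.mulVec f with hg
  have h3 := hpos (f - l⁻¹ • g)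
  have h4 : wInner π (f - l⁻¹ • g) (P.mulVec (f - l⁻¹ • g)) =
      wInner π f g - 2 * l⁻¹ * wInner π g g + l⁻¹ ^ 2 * wInner π g (P.mulVec g) := by
    have e1 : wInner π f (P.mulVec g) = wInner π g g := by rw [wInner_mulVec hr]
    rw [Matrix.mulVec_sub, Matrix.mulVec_smul, ← hg]
    have e2 : wInner π (f - l⁻¹ • g) (g - l⁻¹ • P.mulVec g) = wInner π f g
        - l⁻¹ * wInner π f (P.mulVec g) - l⁻¹ * wInner π g g +
          l⁻¹ ^ 2 * wInner π g (P.mulVec g) := by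
      simp only [wInner, Finset.mul_sum, ← Finset.sum_sub_distrib, ← Finset.sum_add_distrib]
      refine Finset.sum_congr rfl fun x _ => ?_
      simp only [Pi.sub_apply, Pi.smul_apply, smul_eq_mul]
      ring
    rw [e2, e1]; ring
  rw [h4] at h3
  have h5 : l⁻¹ ^ 2 * wInner π g (P.mulVec g) ≤ l⁻¹ * wInner π g g := by
    calc _ ≤ l⁻¹ ^ 2 * (l * wInner π g g) := by gcongr
      _ = _ := by field_simp
  have h6 : l⁻¹ * wInner π g g ≤ l * wInner π f f := by linarith
  calc wInner π g g = l * (l⁻¹ * wInner π g g) := by field_simp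
    _ ≤ l * (l * wInner π f f) := by gcongr
    _ = _ := by ring

lemma wInner_mulVec_self_le {P : Matrix V V ℝ} {π : V → ℝ} (hP : IsStoch P) (hπ : ∀ x, 0 ≤ π x)
    (hr : Rev P π) (hl : ∀ x, 1 / 2 ≤ P x x) (f : V → ℝ) :
    wInner π (P.mulVec f) (P.mulVec f) ≤ wInner π f f := by
  have := wInner_mulVec_mulVec_le hr (wInner_mulVec_nonneg hP hπ hr hl) one_pos (f := f)
    (by rw [one_mul]; exact wInner_mulVec_le hP hπ hr _)
    (by rw [one_mul]; exact wInner_mulVec_le hP hπ hr _)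
  simpa using this

lemma wInner_sq_le {π : V → ℝ} (hπ : ∀ x, 0 ≤ π x) (f g : V → ℝ) :
    wInner π f g ^ 2 ≤ wInner π f f * wInner π g g := by
  have := Finset.sum_mul_sq_le_sq_mul_sq Finset.univ (fun x => √(π x) * f x)
    (fun x => √(π x) * g x)
  have e : ∀ x, √(π x) * √(π x) = π x := fun x => Real.mul_self_sqrt (hπ x)
  have e1 : ∀ (a b : V → ℝ), ∑ x, (√(π x) * a x) * (√(π x) * b x) = wInner π a b := by
    intro a b
    refine Finset.sum_congr rfl fun x _ => ?_
    linear_combination (a x * b x) * e x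
  simp only [sq (_ * _), e1] at this
  exact this

/-! ### Total variation -/

lemma abs_sum_sub_le_tvDist {μ ν g : V → ℝ} {M : ℝ} (hg : ∀ x, |g x| ≤ M) :
    |∑ x, μ x * g x - ∑ x, ν x * g x| ≤ 2 * M * tvDist μ ν := by
  rw [← Finset.sum_sub_distrib]
  refine (Finset.abs_sum_le_sum_abs _ _).trans ?_
  rw [tvDist, mul_div_assoc', le_div_iff₀ two_pos, Finset.sum_mul, Finset.mul_sum]
  refine Finset.sum_le_sum fun x _ => ?_
  rw [← sub_mul, abs_mul]
  nlinarith [hg x, abs_nonneg (μ x - ν x), mul_le_mul_of_nonneg_left (hg x) (abs_nonneg (μ x - ν x))]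

lemma tvDist_le_of_forall {μ ν : V → ℝ} {ε : ℝ}
    (h : ∀ g : V → ℝ, (∀ x, |g x| ≤ 1) → |∑ x, μ x * g x - ∑ x, ν x * g x| ≤ 2 * ε) :
    tvDist μ ν ≤ ε := by
  have h1 := h (fun x => if 0 ≤ μ x - ν x then 1 else -1) (fun x => by split_ifs <;> simp)
  have h2 : ∑ x, |μ x - ν x| = ∑ x, μ x * (if 0 ≤ μ x - ν x then (1 : ℝ) else -1) -
      ∑ x, ν x * (if 0 ≤ μ x - ν x then (1 : ℝ) else -1) := by
    rw [← Finset.sum_sub_distrib]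
    refine Finset.sum_congr rfl fun x _ => ?_
    split_ifs with hx
    · rw [abs_of_nonneg hx]; ring
    · rw [abs_of_neg (not_le.1 hx)]; ring
  rw [tvDist, h2]
  linarith [le_abs_self (∑ x, μ x * (if 0 ≤ μ x - ν x then (1 : ℝ) else -1) -
      ∑ x, ν x * (if 0 ≤ μ x - ν x then (1 : ℝ) else -1))]

lemma tvDist_le_dTV (P : Matrix V V ℝ) (π : V → ℝ) (t : ℕ) (x : V) :
    tvDist ((P ^ t) x) π ≤ dTV P π t :=
  le_ciSup (f := fun x => tvDist ((P ^ t) x) π) (Set.finite_range _).bddAbove x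

lemma dTV_le [Nonempty V] {P : Matrix V V ℝ} {π : V → ℝ} {t : ℕ} {ε : ℝ}
    (h : ∀ x, tvDist ((P ^ t) x) π ≤ ε) : dTV P π t ≤ ε := ciSup_le h

lemma mixTime_le {P : Matrix V V ℝ} {π : V → ℝ} {t : ℕ} {ε : ℝ} (h : dTV P π t ≤ ε) :
    mixTime P π ε ≤ t := Nat.sInf_le h

lemma dTV_mixTime_le {P : Matrix V V ℝ} {π : V → ℝ} {t : ℕ} {ε : ℝ} (h : dTV P π t ≤ ε) :
    dTV P π (mixTime P π ε) ≤ ε :=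
  Nat.sInf_mem (s := {t : ℕ | dTV P π t ≤ ε}) ⟨t, h⟩

/-! ### The spectral gap in terms of the mixing time -/

lemma abs_pow_mulVec_le_half {P : Matrix V V ℝ} {π : V → ℝ} {t : ℕ} (ht : dTV P π t ≤ 1 / 4)
    {f : V → ℝ} {M : ℝ} (hM : ∀ x, |f x| ≤ M) (hf : ∑ x, π x * f x = 0) (x : V) :
    |((P ^ t).mulVec f) x| ≤ M * (1 / 2) := by
  have h1 := abs_sum_sub_le_tvDist (μ := (P ^ t) x) (ν := π) hM
  have hM0 : 0 ≤ M := (abs_nonneg _).trans (hM x)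
  rw [hf, sub_zero] at h1
  refine h1.trans ?_
  have := mul_le_mul_of_nonneg_left ((tvDist_le_dTV P π t x).trans ht) hM0
  linarith

lemma abs_pow_mul_mulVec_le {P : Matrix V V ℝ} {π : V → ℝ} (hP : IsStoch P) (hr : Rev P π) {t : ℕ}
    (ht : dTV P π t ≤ 1 / 4) {f : V → ℝ} {M : ℝ} (hM : ∀ x, |f x| ≤ M)
    (hf : ∑ x, π x * f x = 0) (n : ℕ) (x : V) :
    |((P ^ (n * t)).mulVec f) x| ≤ M * (1 / 2) ^ n := by
  induction n generalizing x with
  | zero => simpa using hM x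
  | succ n ih =>
    rw [Nat.succ_mul, add_comm, pow_add_mulVec, pow_succ, ← mul_assoc]
    exact abs_pow_mulVec_le_half ht ih (by rw [sum_pow_mulVec hP hr, hf]) x

/-- Lower bound on the moments of the spectral measure of a nonnegative operator. -/
lemma wInner_moment {P : Matrix V V ℝ} {π : V → ℝ} (hP : IsStoch P) (hπ : ∀ x, 0 ≤ π x)
    (hr : Rev P π) (hl : ∀ x, 1 / 2 ≤ P x x) (f : V → ℝ) {r : ℝ} (hr0 : 0 ≤ r)
    (h : wInner π f (P.mulVec f) = r * wInner π f f) (s : ℕ) :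
    r * wInner π f ((P ^ s).mulVec f) ≤ wInner π f ((P ^ (s + 1)).mulVec f) := by
  induction s with
  | zero => simp [h]
  | succ s ih =>
    have key : 0 ≤ wInner π f ((P ^ (s + 2)).mulVec f) - 2 * r * wInner π f ((P ^ (s + 1)).mulVec f)
        + r ^ 2 * wInner π f ((P ^ s).mulVec f) := by
      obtain ⟨i, rfl | rfl⟩ := Nat.even_or_odd' s
      · have h0 := wInner_self_nonneg hπ ((P ^ (i + 1)).mulVec f - r • (P ^ i).mulVec f)
        rw [wInner_sub_smul, ← wInner_pow_mulVec hr, ← wInner_pow_mulVec hr,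
          ← wInner_pow_mulVec hr, ← pow_add_mulVec, ← pow_add_mulVec, ← pow_add_mulVec] at h0
        rw [show 2 * i + 2 = i + 1 + (i + 1) by ring, show 2 * i + 1 = i + 1 + i by ring,
          show 2 * i = i + i by ring]
        exact h0
      · have h0 := wInner_mulVec_nonneg hP hπ hr hl
          ((P ^ (i + 1)).mulVec f - r • (P ^ i).mulVec f)
        have e : wInner π ((P ^ (i + 1)).mulVec f - r • (P ^ i).mulVec f)
            (P.mulVec ((P ^ (i + 1)).mulVec f - r • (P ^ i).mulVec f)) =
            wInner π ((P ^ (i + 1)).mulVec f) ((P ^ (i + 2)).mulVec f)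
            - r * wInner π ((P ^ (i + 1)).mulVec f) ((P ^ (i + 1)).mulVec f)
            - r * wInner π ((P ^ i).mulVec f) ((P ^ (i + 2)).mulVec f)
            + r ^ 2 * wInner π ((P ^ i).mulVec f) ((P ^ (i + 1)).mulVec f) := by
          rw [Matrix.mulVec_sub, Matrix.mulVec_smul, ← pow_succ_mulVec, ← pow_succ_mulVec]
          simp only [wInner, Finset.mul_sum, ← Finset.sum_sub_distrib, ← Finset.sum_add_distrib]
          refine Finset.sum_congr rfl fun x _ => ?_
          simp only [Pi.sub_apply, Pi.smul_apply, smul_eq_mul]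
          ring
        rw [e] at h0
        simp only [← wInner_pow_mulVec hr, ← pow_add_mulVec] at h0
        rw [show 2 * i + 1 + 2 = i + 1 + (i + 2) by ring,
          show 2 * i + 1 + 1 = i + 1 + (i + 1) by ring,
          show 2 * i + 1 = i + (i + 1) by ring]
        rw [show i + (i + 2) = i + 1 + (i + 1) by ring] at h0
        linarith
    nlinarith [mul_le_mul_of_nonneg_left ih hr0]

lemma wInner_moment_pow {P : Matrix V V ℝ} {π : V → ℝ} (hP : IsStoch P) (hπ : ∀ x, 0 ≤ π x)
    (hr : Rev P π) (hl : ∀ x, 1 / 2 ≤ P x x) (f : V → ℝ) {r : ℝ} (hr0 : 0 ≤ r)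
    (h : wInner π f (P.mulVec f) = r * wInner π f f) (s : ℕ) :
    r ^ s * wInner π f f ≤ wInner π f ((P ^ s).mulVec f) := by
  induction s with
  | zero => simp
  | succ s ih =>
    refine le_trans ?_ (wInner_moment hP hπ hr hl f hr0 h s)
    rw [pow_succ', mul_assoc]
    exact mul_le_mul_of_nonneg_left ih hr0

/-- The relaxation time is at most twice the mixing time. -/
lemma wInner_mulVec_le_of_dTV [Nonempty V] {P : Matrix V V ℝ} {π : V → ℝ} (hP : IsStoch P)
    (hπ : IsProb π) (hr : Rev P π) (hl : ∀ x, 1 / 2 ≤ P x x) {t : ℕ} (ht0 : 0 < t)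
    (ht : dTV P π t ≤ 1 / 4) {f : V → ℝ} (hf : ∑ x, π x * f x = 0) :
    wInner π f (P.mulVec f) ≤ (1 - 1 / (2 * t)) * wInner π f f := by
  have hπ0 := fun x => (hπ.1 x).le
  have htr : (0 : ℝ) < t := by exact_mod_cast ht0
  rcases (wInner_self_nonneg hπ0 f).eq_or_lt with h0 | h0
  · have := wInner_mulVec_le hP hπ0 hr f
    rw [← h0] at this ⊢
    simpa using this
  set r := wInner π f (P.mulVec f) / wInner π f f with hrdef
  have hr0 : 0 ≤ r := div_nonneg (wInner_mulVec_nonneg hP hπ0 hr hl f) h0.le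
  have hre : wInner π f (P.mulVec f) = r * wInner π f f := by rw [hrdef]; field_simp
  rw [hre]
  refine mul_le_mul_of_nonneg_right ?_ h0.le
  obtain ⟨M, hM⟩ : ∃ M, ∀ x, |f x| ≤ M := by
    obtain ⟨M, hM⟩ := (Set.finite_range fun x => |f x|).bddAbove
    exact ⟨M, fun x => hM ⟨x, rfl⟩⟩
  have hM0 : 0 ≤ M := (abs_nonneg _).trans (hM (Classical.arbitrary V))
  have hbound : ∀ n : ℕ, (2 * r ^ t) ^ n * wInner π f f ≤ M ^ 2 := by
    intro n
    have h1 := wInner_moment_pow hP hπ0 hr hl f hr0 hre (n * t)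
    have h2 : wInner π f ((P ^ (n * t)).mulVec f) ≤ M ^ 2 * (1 / 2) ^ n := by
      calc _ ≤ ∑ x, π x * (M * (M * (1 / 2) ^ n)) := by
            refine Finset.sum_le_sum fun x _ => mul_le_mul_of_nonneg_left ?_ (hπ0 x)
            refine (le_abs_self _).trans ?_
            rw [abs_mul]
            exact mul_le_mul (hM x) (abs_pow_mul_mulVec_le hP hr ht hM hf n x) (abs_nonneg _) hM0
        _ = _ := by rw [← Finset.sum_mul, hπ.2]; ring
    calc (2 * r ^ t) ^ n * wInner π f f = 2 ^ n * (r ^ (n * t) * wInner π f f) := by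
          rw [mul_pow, ← pow_mul, mul_comm t n]; ring
      _ ≤ 2 ^ n * (M ^ 2 * (1 / 2) ^ n) := mul_le_mul_of_nonneg_left (h1.trans h2) (by positivity)
      _ = M ^ 2 := by rw [one_div, inv_pow]; field_simp
  have hrt : 2 * r ^ t ≤ 1 := by
    by_contra! hcon
    obtain ⟨n, hn⟩ := pow_unbounded_of_one_lt (M ^ 2 / wInner π f f) hcon
    rw [div_lt_iff₀ h0] at hn
    exact absurd (hbound n) (not_le.2 hn)
  have hb := one_add_mul_le_pow (a := r - 1) (by linarith) t
  have : (t : ℝ) * (1 - r) ≥ 1 / 2 := by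
    rw [add_sub_cancel] at hb; linarith
  have h3 : 1 / (2 * (t : ℝ)) ≤ 1 - r := by
    rw [div_le_iff₀ (by positivity)]; linarith
  linarith

/-! ### Lumped chains -/

section Lump

variable {k : ℕ} {P : Matrix V V ℝ} {π : V → ℝ} {p : V → Fin k}

lemma sum_lumpSta (π : V → ℝ) (p : V → Fin k) (g : Fin k → ℝ) :
    ∑ i, lumpSta π p i * g i = ∑ a, π a * g (p a) := by
  simp only [lumpSta, Finset.sum_mul, ite_mul, zero_mul]
  rw [Finset.sum_comm]
  simp

lemma lumpSta_apply_le (hπ : IsProb π) (a : V) : π a ≤ lumpSta π p (p a) := by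
  refine le_trans (by simp) (Finset.single_le_sum (f := fun b => if p b = p a then π b else 0)
    (fun b _ => ?_) (Finset.mem_univ a))
  split_ifs
  exacts [(hπ.1 b).le, le_rfl]

lemma isProb_lumpSta (hπ : IsProb π) (hp : Function.Surjective p) : IsProb (lumpSta π p) := by
  refine ⟨fun i => ?_, ?_⟩
  · obtain ⟨a, rfl⟩ := hp i
    exact (hπ.1 a).trans_le (lumpSta_apply_le hπ a)
  · have := sum_lumpSta π p (fun _ => 1)
    simpa [hπ.2] using this

lemma lumpSta_mul_mulVec (hπ : IsProb π) (hp : Function.Surjective p) (g : Fin k → ℝ) (i : Fin k) :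
    lumpSta π p i * ((lumpMat P π p).mulVec g) i =
      ∑ a, if p a = i then π a * (P.mulVec (fun b => g (p b))) a else 0 := by
  have h0 := ((isProb_lumpSta hπ hp).1 i).ne'
  simp only [lumpMat, Matrix.mulVec, dotProduct, Matrix.of_apply]
  rw [Finset.mul_sum]
  have : ∀ j, lumpSta π p i * ((∑ a, ∑ b, if p a = i ∧ p b = j then π a * P a b else 0) /
      (∑ a, if p a = i then π a else 0) * g j) =
      ∑ a, ∑ b, if p a = i ∧ p b = j then π a * P a b * g j else 0 := by
    intro j
    change lumpSta π p i * (_ / lumpSta π p i * g j) = _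
    rw [← mul_assoc, mul_div_cancel₀ _ h0]
    simp only [Finset.sum_mul, ite_mul, zero_mul]
  simp only [this]
  rw [Finset.sum_comm]
  refine Finset.sum_congr rfl fun a _ => ?_
  rw [Finset.sum_comm]
  by_cases ha : p a = i
  · simp only [ha, true_and, if_true, Finset.mul_sum]
    refine Finset.sum_congr rfl fun b _ => ?_
    simp [mul_assoc]
  · simp [ha]

lemma isStoch_lumpMat (hP : IsStoch P) (hπ : IsProb π) (hp : Function.Surjective p) :
    IsStoch (lumpMat P π p) := by
  refine ⟨fun i j => div_nonneg ?_ ((isProb_lumpSta hπ hp).1 i).le, fun i => ?_⟩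
  · refine Finset.sum_nonneg fun a _ => Finset.sum_nonneg fun b _ => ?_
    split_ifs
    exacts [mul_nonneg (hπ.1 a).le (hP.1 a b), le_rfl]
  · have h := lumpSta_mul_mulVec (P := P) hπ hp (fun _ => 1) i
    rw [mulVec_one hP] at h
    simp only [mul_one] at h
    have h2 := mul_left_cancel₀ ((isProb_lumpSta hπ hp).1 i).ne'
      (h.trans (mul_one (lumpSta π p i)).symm)
    simpa [Matrix.mulVec, dotProduct] using h2

lemma rev_lumpMat (hπ : IsProb π) (hp : Function.Surjective p) (hr : Rev P π) :
    Rev (lumpMat P π p) (lumpSta π p) := by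
  have key : ∀ i j, lumpSta π p i * lumpMat P π p i j =
      ∑ a, ∑ b, if p a = i ∧ p b = j then π a * P a b else 0 := fun i j =>
    mul_div_cancel₀ _ ((isProb_lumpSta hπ hp).1 i).ne'
  intro i j
  rw [key, key, Finset.sum_comm]
  refine Finset.sum_congr rfl fun a _ => Finset.sum_congr rfl fun b _ => ?_
  simp only [hr a b, and_comm]

lemma wInner_lump (hπ : IsProb π) (hp : Function.Surjective p) (f g : Fin k → ℝ) :
    wInner (lumpSta π p) f ((lumpMat P π p).mulVec g) =
      wInner π (fun a => f (p a)) (P.mulVec fun a => g (p a)) := by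
  have : ∀ i, lumpSta π p i * (f i * ((lumpMat P π p).mulVec g) i) =
      ∑ a, if p a = i then π a * (f i * (P.mulVec (fun b => g (p b))) a) else 0 := by
    intro i
    rw [mul_left_comm, lumpSta_mul_mulVec hπ hp, Finset.mul_sum]
    refine Finset.sum_congr rfl fun a _ => ?_
    split_ifs <;> ring
  simp only [wInner, this]
  rw [Finset.sum_comm]
  simp

lemma wInner_lump_self (f g : Fin k → ℝ) :
    wInner (lumpSta π p) f g = wInner π (fun a => f (p a)) (fun a => g (p a)) :=
  sum_lumpSta π p fun i => f i * g i

/-- A lumped chain mixes in time `t_mix * log (1 / π_min)`. -/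
lemma dTV_lump_le [Nonempty V] (hP : IsStoch P) (hπ : IsProb π) (hr : Rev P π)
    (hl : ∀ x, 1 / 2 ≤ P x x) (hp : Function.Surjective p) {s : ℕ} (hs0 : 0 < s)
    (hs : dTV P π s ≤ 1 / 4) {c : ℝ} (hc : 0 < c) (hcπ : ∀ a, c ≤ π a) {t : ℕ}
    (ht : s * Real.log (4 / c) ≤ t) :
    dTV (lumpMat P π p) (lumpSta π p) t ≤ 1 / 4 := by
  set Q := lumpMat P π p
  set ρ := lumpSta π p
  have hQ : IsStoch Q := isStoch_lumpMat hP hπ hp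
  have hρ : IsProb ρ := isProb_lumpSta hπ hp
  have hQr : Rev Q ρ := rev_lumpMat hπ hp hr
  have hs1 : (1 : ℝ) ≤ s := by exact_mod_cast hs0
  set l : ℝ := 1 - 1 / (2 * s) with hldef
  have hl0 : 0 < l := by
    have : 1 / (2 * (s : ℝ)) < 1 := by rw [div_lt_one (by positivity)]; linarith
    linarith
  have hpos : ∀ f, 0 ≤ wInner ρ f (Q.mulVec f) := fun f => by
    rw [wInner_lump hπ hp]; exact wInner_mulVec_nonneg hP (fun x => (hπ.1 x).le) hr hl _
  have hgap : ∀ f, ∑ i, ρ i * f i = 0 → wInner ρ f (Q.mulVec f) ≤ l * wInner ρ f f := by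
    intro f hf
    rw [wInner_lump hπ hp, wInner_lump_self]
    exact wInner_mulVec_le_of_dTV hP hπ hr hl hs0 hs (by rw [← sum_lumpSta]; exact hf)
  have hnorm : ∀ f, ∑ i, ρ i * f i = 0 → ∀ n : ℕ,
      wInner ρ ((Q ^ n).mulVec f) ((Q ^ n).mulVec f) ≤ (l ^ 2) ^ n * wInner ρ f f := by
    intro f hf n
    induction n with
    | zero => simp
    | succ n ih =>
      have hz : ∑ i, ρ i * ((Q ^ n).mulVec f) i = 0 := by rw [sum_pow_mulVec hQ hQr, hf]
      rw [pow_succ_mulVec, pow_succ', mul_assoc]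
      refine (wInner_mulVec_mulVec_le hQr hpos hl0 (hgap _ hz) (hgap _ ?_)).trans
        (mul_le_mul_of_nonneg_left ih (sq_nonneg l))
      rw [sum_mulVec hQ hQr, hz]
  have hlt : (l ^ 2) ^ t ≤ c / 4 := by
    have h1 : l ≤ Real.exp (-(1 / (2 * s))) := by
      have := Real.add_one_le_exp (-(1 / (2 * (s : ℝ))))
      linarith
    calc (l ^ 2) ^ t ≤ ((Real.exp (-(1 / (2 * s)))) ^ 2) ^ t := by gcongr
      _ = Real.exp (-(t / s)) := by
        rw [← Real.exp_nat_mul, ← Real.exp_nat_mul]; congr 1; push_cast; field_simp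
      _ ≤ Real.exp (-Real.log (4 / c)) := by
        gcongr
        rw [le_div_iff₀ (by positivity), mul_comm]
        exact ht
      _ = c / 4 := by rw [← Real.log_inv, Real.exp_log (by positivity), inv_div]
  have : Nonempty (Fin k) := ⟨p (Classical.arbitrary V)⟩
  refine dTV_le fun i => tvDist_le_of_forall fun g hg => ?_
  change |((Q ^ t).mulVec g) i - ∑ j, ρ j * g j| ≤ _
  set b := ∑ j, ρ j * g j with hb
  have hf : ∑ j, ρ j * (g - b • fun _ : Fin k => (1 : ℝ)) j = 0 := by
    simp only [Pi.sub_apply, Pi.smul_apply, smul_eq_mul, mul_one, mul_sub,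
      Finset.sum_sub_distrib, ← Finset.sum_mul, hρ.2, one_mul, ← hb, sub_self]
  have h1 := hnorm _ hf t
  have h2 : wInner ρ (g - b • fun _ => (1 : ℝ)) (g - b • fun _ => (1 : ℝ)) ≤ 1 := by
    rw [wInner_sub_smul]
    have e1 : wInner ρ g (fun _ => 1) = b := by simp [wInner, hb]
    have e2 : wInner ρ (fun _ => 1) (fun _ => 1) = 1 := by simp [wInner, hρ.2]
    have e3 : wInner ρ g g ≤ 1 := by
      rw [← hρ.2]
      refine Finset.sum_le_sum fun j _ => mul_le_of_le_one_right (hρ.1 j).le ?_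
      rw [← sq, sq_le_one_iff_abs_le_one]
      exact hg j
    rw [e1, e2]; nlinarith [sq_nonneg b]
  have h3 : ((Q ^ t).mulVec (g - b • fun _ => (1 : ℝ))) i = ((Q ^ t).mulVec g) i - b := by
    rw [Matrix.mulVec_sub, Matrix.mulVec_smul, pow_mulVec_one hQ]
    simp
  have h4 : c * (((Q ^ t).mulVec g) i - b) ^ 2 ≤ c / 4 := by
    rw [← h3]
    refine le_trans ?_ ((h1.trans (mul_le_mul hlt h2 ?_ (by positivity))).trans (mul_one _).le)
    · refine le_trans ?_ (Finset.single_le_sum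
        (f := fun j => ρ j * (((Q ^ t).mulVec (g - b • fun _ => (1 : ℝ))) j *
          ((Q ^ t).mulVec (g - b • fun _ => (1 : ℝ))) j))
        (fun j _ => mul_nonneg (hρ.1 j).le (mul_self_nonneg _)) (Finset.mem_univ i))
      rw [← sq]
      obtain ⟨a, rfl⟩ := hp i
      exact mul_le_mul_of_nonneg_right ((hcπ a).trans (lumpSta_apply_le hπ a)) (sq_nonneg _)
    · exact wInner_self_nonneg (fun j => (hρ.1 j).le) _
  have h5 : (((Q ^ t).mulVec g) i - b) ^ 2 ≤ (1 / 2) ^ 2 := by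
    refine le_of_mul_le_mul_left (h4.trans ?_) hc
    linarith
  have := abs_le_of_sq_le_sq h5 (by norm_num)
  linarith

/-- A supersolution of the lumped chain that is small somewhere and large on average bounds the
mixing time from below. -/
lemma lt_dTV_lump (hP : IsStoch P) (hπ : IsProb π) (hp : Function.Surjective p)
    {ψ : Fin k → ℝ} (h0 : ∀ i, 0 ≤ ψ i) (h1 : ∀ i, ψ i ≤ 1) {θ : ℝ} (hθ : 0 ≤ θ)
    (hψ : ∀ i, ((∑ a, if p a = i then π a * (P.mulVec (fun b => ψ (p b))) a else 0)) ≤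
      (1 + θ) * ∑ a, if p a = i then π a * ψ (p a) else 0)
    {t : ℕ} {x : V} (hx : (1 + θ) ^ t * ψ (p x) < 1 / 8)
    (hm : 3 / 8 ≤ ∑ a, π a * ψ (p a)) :
    1 / 4 < dTV (lumpMat P π p) (lumpSta π p) t := by
  by_contra! hcon
  set Q := lumpMat P π p
  set ρ := lumpSta π p
  have hQ : IsStoch Q := isStoch_lumpMat hP hπ hp
  have hρ : IsProb ρ := isProb_lumpSta hπ hp
  have hstep : ∀ i, (Q.mulVec ψ) i ≤ (1 + θ) * ψ i := by
    intro i
    refine le_of_mul_le_mul_left ?_ (hρ.1 i)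
    rw [lumpSta_mul_mulVec hπ hp]
    refine (hψ i).trans (le_of_eq ?_)
    rw [mul_left_comm]
    congr 1
    simp only [ρ, lumpSta, Finset.sum_mul, ite_mul, zero_mul]
    refine Finset.sum_congr rfl fun a _ => ?_
    split_ifs with h
    · rw [h]
    · rfl
  have hpow : ∀ n i, ((Q ^ n).mulVec ψ) i ≤ (1 + θ) ^ n * ψ i := by
    intro n
    induction n with
    | zero => simp
    | succ n ih =>
      intro i
      rw [pow_succ_mulVec]
      refine (mulVec_le hQ ih i).trans ?_
      have : (Q.mulVec fun x => (1 + θ) ^ n * ψ x) i = (1 + θ) ^ n * (Q.mulVec ψ) i := by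
        simp only [Matrix.mulVec, dotProduct, Finset.mul_sum]
        exact Finset.sum_congr rfl fun j _ => by ring
      rw [this, pow_succ, mul_assoc]
      exact mul_le_mul_of_nonneg_left (hstep i) (by positivity)
  have h2 := abs_sum_sub_le_tvDist (μ := (Q ^ t) (p x)) (ν := ρ) (g := fun i => ψ i - 1 / 2)
    (M := 1 / 2) (fun i => by rw [abs_le]; constructor <;> linarith [h0 i, h1 i])
  have h3 := (tvDist_le_dTV Q ρ t (p x)).trans hcon
  have hst : ∑ j, (Q ^ t) (p x) j = 1 := by
    simpa [Matrix.mulVec, dotProduct] using congrFun (pow_mulVec_one hQ t) (p x)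
  have h4 : ∑ j, (Q ^ t) (p x) j * (ψ j - 1 / 2) = ((Q ^ t).mulVec ψ) (p x) - 1 / 2 := by
    simp only [mul_sub, Finset.sum_sub_distrib, ← Finset.sum_mul, hst, one_mul]
    rfl
  have h5 : ∑ j, ρ j * (ψ j - 1 / 2) = ∑ a, π a * ψ (p a) - 1 / 2 := by
    rw [← sum_lumpSta π p ψ]
    simp only [mul_sub, Finset.sum_sub_distrib, ← Finset.sum_mul, hρ.2, one_mul, ρ]
  rw [h4, h5] at h2
  have := (abs_le.1 h2).1
  have := hpow t (p x)
  linarith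

end Lump

/-! ### The lazy random walk on a graph -/

section Walk

variable {G : SimpleGraph V}

open Classical in
lemma deg_eq_card (v : V) : deg G v = (univ.filter fun u => G.Adj v u).card := by
  rw [deg, Nat.card_eq_fintype_card, Fintype.card_subtype]

open Classical in
lemma walkMat_mulVec (f : V → ℝ) (v : V) : ((walkMat G).mulVec f) v =
    f v / 2 + 1 / (2 * (deg G v : ℝ)) * ∑ u, if G.Adj v u then f u else 0 := by
  have : ∀ u, walkMat G v u * f u = (if v = u then f u / 2 else 0) +
      1 / (2 * (deg G v : ℝ)) * (if G.Adj v u then f u else 0) := by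
    intro u
    simp only [walkMat, Matrix.of_apply]
    by_cases h : v = u
    · subst h; simp; ring
    · by_cases h' : G.Adj v u <;> simp [h, h']
  simp only [Matrix.mulVec, dotProduct, this, Finset.sum_add_distrib, ← Finset.mul_sum]
  simp

lemma half_le_walkMat (v : V) : 1 / 2 ≤ walkMat G v v := by simp [walkMat]

lemma isStoch_walkMat (hG : ∀ v, 0 < deg G v) : IsStoch (walkMat G) := by
  classical
  refine ⟨fun i j => ?_, fun i => ?_⟩
  · simp only [walkMat, Matrix.of_apply]
    split_ifs <;> positivity
  · have := walkMat_mulVec (G := G) (fun _ => 1) i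
    simp only [Matrix.mulVec, dotProduct, mul_one] at this
    rw [this, Finset.sum_boole, ← deg_eq_card]
    have : (deg G i : ℝ) ≠ 0 := by exact_mod_cast (hG i).ne'
    field_simp
    norm_num

lemma isProb_degSta [Nonempty V] (hG : ∀ v, 0 < deg G v) : IsProb (degSta G) := by
  have h : (0 : ℝ) < ∑ u, (deg G u : ℝ) :=
    Finset.sum_pos (fun v _ => by exact_mod_cast hG v) Finset.univ_nonempty
  refine ⟨fun v => div_pos (by exact_mod_cast hG v) h, ?_⟩
  simp only [degSta, ← Finset.sum_div]
  exact div_self h.ne'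

lemma rev_walkMat (hG : ∀ v, 0 < deg G v) : Rev (walkMat G) (degSta G) := by
  intro i j
  by_cases h : i = j
  · rw [h]
  · simp only [walkMat, Matrix.of_apply, degSta, h, Ne.symm h, if_false]
    have hi : (deg G i : ℝ) ≠ 0 := by exact_mod_cast (hG i).ne'
    have hj : (deg G j : ℝ) ≠ 0 := by exact_mod_cast (hG j).ne'
    by_cases hij : G.Adj i j
    · rw [if_pos hij, if_pos hij.symm]
      field_simp
    · rw [if_neg hij, if_neg fun h => hij h.symm]
      simp

lemma le_degSta {D : ℕ} (hG : ∀ v, 0 < deg G v) (hD : ∀ v, deg G v ≤ D) (v : V) :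
    1 / ((D : ℝ) * Fintype.card V) ≤ degSta G v := by
  have h : ∑ u, (deg G u : ℝ) ≤ D * Fintype.card V := by
    calc _ ≤ ∑ _u : V, (D : ℝ) := Finset.sum_le_sum fun u _ => by exact_mod_cast hD u
      _ = _ := by simp [mul_comm]
  have h0 : (0 : ℝ) < ∑ u, (deg G u : ℝ) :=
    Finset.sum_pos (fun v _ => by exact_mod_cast hG v) ⟨v, Finset.mem_univ v⟩
  exact div_le_div₀ (Nat.cast_nonneg _) (by exact_mod_cast hG v) h0 h

/-- A random walk that mixes lives on a connected graph. -/
lemma connected_of_dTV_lt [Nonempty V] (hG : ∀ v, 0 < deg G v) {t : ℕ}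
    (ht : dTV (walkMat G) (degSta G) t ≤ 1 / 4) : G.Connected := by
  classical
  have hP := isStoch_walkMat hG
  have hπ := isProb_degSta hG
  refine { preconnected := fun a b => ?_, nonempty := inferInstance }
  set f : V → ℝ := fun v => if G.Reachable a v then 1 else 0 with hf
  have hinv : (walkMat G).mulVec f = f := by
    funext v
    rw [walkMat_mulVec]
    have : ∀ u, (if G.Adj v u then f u else 0) = f v * (if G.Adj v u then 1 else 0) := by
      intro u
      by_cases h : G.Adj v u
      · have : G.Reachable a u ↔ G.Reachable a v :=
          ⟨fun h' => h'.trans h.symm.reachable, fun h' => h'.trans h.reachable⟩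
        simp [h, hf, this]
      · simp [h]
    simp only [this, ← Finset.mul_sum]
    rw [Finset.sum_boole, ← deg_eq_card]
    have : (deg G v : ℝ) ≠ 0 := by exact_mod_cast (hG v).ne'
    field_simp
    ring
  have hpow : ∀ n : ℕ, ((walkMat G) ^ n).mulVec f = f := fun n => by
    induction n with
    | zero => simp
    | succ n ih => rw [pow_succ_mulVec, ih, hinv]
  by_contra hab
  have key : ∀ x, |f x - ∑ y, degSta G y * f y| ≤ 2 * 1 * (1 / 4) / 2 + 1 / 8 := by
    intro x
    have h1 := abs_sum_sub_le_tvDist (μ := ((walkMat G) ^ t) x) (ν := degSta G)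
      (g := fun v => f v - 1 / 2) (M := 1 / 2) (fun v => by
        simp only [hf]; split_ifs <;> norm_num [abs_le])
    have h2 := (tvDist_le_dTV _ _ t x).trans ht
    have h3 : ∑ y, ((walkMat G) ^ t) x y * (f y - 1 / 2) = f x - 1 / 2 := by
      have e1 := congrFun (hpow t) x
      have e2 := congrFun (pow_mulVec_one hP t) x
      simp only [Matrix.mulVec, dotProduct, mul_one] at e1 e2
      simp only [mul_sub, Finset.sum_sub_distrib, ← Finset.sum_mul, e1, e2, one_mul]
    have h4 : ∑ y, degSta G y * (f y - 1 / 2) = ∑ y, degSta G y * f y - 1 / 2 := by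
      simp only [mul_sub, Finset.sum_sub_distrib, ← Finset.sum_mul, hπ.2, one_mul]
    rw [h3, h4, sub_sub_sub_cancel_right] at h1
    linarith
  have ha := abs_le.1 (key a)
  have hb := abs_le.1 (key b)
  have e1 : f a = 1 := by simp [hf]
  have e2 : f b = 0 := by simp [hf, hab]
  rw [e1] at ha
  rw [e2] at hb
  linarith [ha.2, hb.1]

end Walk

/-! ### Transport along an equivalence -/

section Transport

variable {W : Type} [Fintype W] [DecidableEq W] (e : W ≃ V) (G : SimpleGraph V)

lemma deg_comap (v : W) : deg (G.comap e) v = deg G (e v) :=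
  Nat.card_congr (e.subtypeEquiv fun _ => Iff.rfl)

lemma walkMat_comap : walkMat (G.comap e) = (walkMat G).submatrix e e := by
  ext i j
  simp only [walkMat, deg_comap, Matrix.of_apply, Matrix.submatrix_apply, e.injective.eq_iff]
  rfl

lemma degSta_comap (v : W) : degSta (G.comap e) v = degSta G (e v) := by
  simp only [degSta, deg_comap]
  rw [Equiv.sum_comp e fun u => (deg G u : ℝ)]

lemma submatrix_pow (P : Matrix V V ℝ) (t : ℕ) : (P.submatrix e e) ^ t = (P ^ t).submatrix e e := by
  induction t with
  | zero => simp
  | succ t ih => rw [pow_succ, ih, pow_succ, Matrix.submatrix_mul_equiv]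

lemma dTV_submatrix (P : Matrix V V ℝ) (π : V → ℝ) (t : ℕ) :
    dTV (P.submatrix e e) (fun w => π (e w)) t = dTV P π t := by
  simp only [dTV, submatrix_pow]
  refine e.iSup_congr fun x => ?_
  simp only [tvDist, Matrix.submatrix_apply]
  rw [← Equiv.sum_comp e]

lemma tmixG_comap (ε : ℝ) : tmixG (G.comap e) ε = tmixG G ε := by
  have : degSta (G.comap e) = fun w => degSta G (e w) := funext (degSta_comap e G)
  simp only [tmixG, mixTime, walkMat_comap, this, dTV_submatrix]

lemma lumpMat_submatrix {k : ℕ} (P : Matrix V V ℝ) (π : V → ℝ) (p : V → Fin k) :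
    lumpMat (P.submatrix e e) (fun w => π (e w)) (fun w => p (e w)) = lumpMat P π p := by
  ext i j
  simp only [lumpMat, Matrix.of_apply, Matrix.submatrix_apply]
  rw [← Equiv.sum_comp e fun a => if p a = i then π a else 0, ← Equiv.sum_comp e fun a => ∑ b,
    if p a = i ∧ p b = j then π a * P a b else 0]
  congr 1
  refine Finset.sum_congr rfl fun a _ => ?_
  rw [← Equiv.sum_comp e]

lemma lumpSta_comp {k : ℕ} (π : V → ℝ) (p : V → Fin k) :
    lumpSta (fun w => π (e w)) (fun w => p (e w)) = lumpSta π p := by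
  funext i
  exact Equiv.sum_comp e fun a => if p a = i then π a else 0

end Transport

/-! ### The graphs: a binary tree glued to a labelled cover of a binary tree -/

/-- Nodes of the base tree: the root `o`, the left subtree `L`, and the right subtree, which
consists of the top part `T` and of the labelled part `B`. -/
inductive Node : Type
  | o : Node
  | L : List Bool → Node
  | T : List Bool → Node
  | B : List Bool → Node

namespace Lamp

instance : DecidableEq Node := Classical.decEq _

/-- The cover has `2 ^ (2 * m)` sheets. -/
abbrev Sheet (m : ℕ) : Type := Fin (2 * m) → Bool

/-- Nodes of the tree of depth `3 * m` whose top part has depth `m`. -/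
def Valid (m : ℕ) : Node → Prop
  | .o => True
  | .L u => u.length < 3 * m
  | .T u => u.length < m
  | .B u => m ≤ u.length + 1 ∧ u.length + 1 < 3 * m

/-- The parent of a node. -/
def par (m : ℕ) : Node → Node
  | .o => .o
  | .L [] => .o
  | .L (_ :: u) => .L u
  | .T [] => .o
  | .T (_ :: u) => .T u
  | .B u => if u.length < m then .T u else .B u.tail

/-- Set the `i`-th bit of a sheet to `b`. -/
def upd {m : ℕ} (z : Sheet m) (i : ℕ) (b : Bool) : Sheet m := fun j => if j.val = i then b else z j

/-- The neighbours of a vertex of the cover. -/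
def nb (m : ℕ) : Node → Sheet m → List (Node × Sheet m)
  | .o, z => [(.L [], z), (.T [], z)]
  | .L u, z => (par m (.L u), z) ::
      if u.length + 1 < 3 * m then [(.L (false :: u), z), (.L (true :: u), z)] else []
  | .T u, z => (par m (.T u), z) ::
      if u.length + 1 < m then [(.T (false :: u), z), (.T (true :: u), z)]
      else [(.B u, upd z 0 false), (.B u, upd z 0 true)]
  | .B u, z => (par m (.B u), upd z (u.length + 1 - m) false) ::
      (par m (.B u), upd z (u.length + 1 - m) true) ::
      if u.length + 2 < 3 * m then
        [(.B (false :: u), upd z (u.length + 2 - m) false),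
          (.B (false :: u), upd z (u.length + 2 - m) true),
          (.B (true :: u), upd z (u.length + 2 - m) false),
          (.B (true :: u), upd z (u.length + 2 - m) true)]
      else []

lemma upd_upd {m : ℕ} (z : Sheet m) (i : ℕ) (b c : Bool) : upd (upd z i b) i c = upd z i c := by
  funext j
  simp only [upd]
  split_ifs <;> rfl

lemma upd_false_ne_upd_true {m i : ℕ} (hi : i < 2 * m) (z : Sheet m) :
    upd z i false ≠ upd z i true := fun h => by
  simpa [upd] using congrFun h ⟨i, hi⟩

lemma mem_upd_comm {m : ℕ} {z z' : Sheet m} {i : ℕ} (h : z' = upd z i false ∨ z' = upd z i true) :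
    z = upd z' i false ∨ z = upd z' i true := by
  have key : ∀ b, z' = upd z i b → z = upd z' i false ∨ z = upd z' i true := by
    rintro b rfl
    simp only [upd_upd]
    by_cases hi : i < 2 * m
    · have : z = upd z i (z ⟨i, hi⟩) := by
        funext j
        simp only [upd]
        split_ifs with hj
        · subst hj; rfl
        · rfl
      cases hb : z ⟨i, hi⟩ <;> rw [hb] at this
      exacts [Or.inl this, Or.inr this]
    · left
      funext j
      simp only [upd]
      rw [if_neg (by have := j.2; omega)]
  exact h.elim (key _) (key _)

lemma valid_par {m : ℕ} {n : Node} (hn : Valid m n) : Valid m (par m n) := by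
  rcases n with _ | (_ | ⟨x, u⟩) | (_ | ⟨x, u⟩) | u <;> simp only [par]
  · trivial
  · trivial
  · simp only [Valid, List.length_cons] at hn ⊢; omega
  · trivial
  · simp only [Valid, List.length_cons] at hn ⊢; omega
  · split_ifs with h
    · exact h
    · simp only [Valid, List.length_tail] at hn ⊢; omega

lemma valid_of_mem_nb {m : ℕ} (hm : 1 ≤ m) {n : Node} (hn : Valid m n) {z : Sheet m}
    {x : Node × Sheet m} (hx : x ∈ nb m n z) : Valid m x.1 := by
  have hp := valid_par hn
  rcases n with _ | u | u | u <;> simp only [nb] at hx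
  · simp only [List.mem_cons, List.not_mem_nil, or_false] at hx
    rcases hx with rfl | rfl <;> simp only [Valid, List.length_nil] <;> omega
  all_goals
    split_ifs at hx
    all_goals
      simp only [List.mem_cons, List.not_mem_nil, or_false] at hx
      simp only [Valid] at hn
      rcases hx with rfl | hx
      · exact hp
      try rcases hx with rfl | hx
      all_goals first
        | exact hp
        | (rcases hx with rfl | rfl | rfl | rfl
           all_goals simp only [Valid, List.length_cons]; omega)
        | (simp only [Valid, List.length_cons]; omega)

lemma mem_nb_symm {m : ℕ} {n n' : Node} (hn : Valid m n) (hn' : Valid m n') {z z' : Sheet m}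
    (h : (n', z') ∈ nb m n z) : (n, z) ∈ nb m n' z' := by
  rcases n with _ | u | u | u <;> simp only [nb] at h
  · simp only [List.mem_cons, List.not_mem_nil, or_false, Prod.mk.injEq] at h
    rcases h with ⟨rfl, rfl⟩ | ⟨rfl, rfl⟩ <;> simp [nb, par]
  · rcases u with _ | ⟨x, u⟩ <;> split_ifs at h <;>
      simp only [List.mem_cons, List.not_mem_nil, or_false, Prod.mk.injEq, par] at h
    · rcases h with ⟨rfl, rfl⟩ | ⟨rfl, rfl⟩ | ⟨rfl, rfl⟩ <;> simp [nb, par]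
    · rcases h with ⟨rfl, rfl⟩ ; simp [nb]
    · rcases h with ⟨rfl, rfl⟩ | ⟨rfl, rfl⟩ | ⟨rfl, rfl⟩
      · simp only [Valid, List.length_cons] at hn
        cases x <;> simp [nb, hn]
      · simp [nb, par]
      · simp [nb, par]
    · rcases h with ⟨rfl, rfl⟩
      simp only [Valid, List.length_cons] at hn
      cases x <;> simp [nb, hn]
  · rcases u with _ | ⟨x, u⟩ <;> split_ifs at h with hu <;>
      simp only [List.mem_cons, List.not_mem_nil, or_false, Prod.mk.injEq, par] at h
    · rcases h with ⟨rfl, rfl⟩ | ⟨rfl, rfl⟩ | ⟨rfl, rfl⟩ <;> simp [nb, par]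
    · rcases h with ⟨rfl, rfl⟩ | ⟨rfl, h⟩ | ⟨rfl, h⟩
      · simp [nb]
      all_goals
        have := mem_upd_comm (z := z) (z' := z') (i := 0) (by tauto)
        simp only [Valid] at hn hn'
        rw [List.length_nil] at *
        simp [nb, par, this, hn, show 1 - m = 0 by omega]
    · rcases h with ⟨rfl, rfl⟩ | ⟨rfl, rfl⟩ | ⟨rfl, rfl⟩
      · simp only [Valid, List.length_cons] at hn
        cases x <;> simp [nb, hn]
      · simp [nb, par]
      · simp [nb, par]
    · rcases h with ⟨rfl, rfl⟩ | ⟨rfl, h⟩ | ⟨rfl, h⟩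
      · simp only [Valid, List.length_cons] at hn
        cases x <;> simp [nb, hn]
      all_goals
        have := mem_upd_comm (z := z) (z' := z') (i := 0) (by tauto)
        simp only [Valid, List.length_cons] at hn hn' hu
        simp [nb, par, this, hn, show u.length + 1 + 1 - m = 0 by omega]
  · have h' : n' = par m (.B u) ∧ (z' = upd z (u.length + 1 - m) false ∨
        z' = upd z (u.length + 1 - m) true) ∨ u.length + 2 < 3 * m ∧
        (n' = .B (false :: u) ∨ n' = .B (true :: u)) ∧ (z' = upd z (u.length + 2 - m) false ∨
        z' = upd z (u.length + 2 - m) true) := by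
      split_ifs at h <;>
        simp only [List.mem_cons, List.not_mem_nil, or_false, Prod.mk.injEq] at h <;> tauto
    rcases h' with ⟨rfl, h'⟩ | ⟨hu, h1, h2⟩
    · have := mem_upd_comm h'
      simp only [Valid] at hn
      simp only [par]
      split_ifs with hu
      · simp only [nb]
        rw [if_neg (by omega)]
        rw [show u.length + 1 - m = 0 by omega] at this
        simp only [List.mem_cons, Prod.mk.injEq, true_and, List.not_mem_nil, or_false]
        tauto
      · rcases u with _ | ⟨x, u⟩
        · simp at hu hn; omega
        · simp only [List.length_cons] at this hu hn
          rw [List.tail_cons, nb, if_pos (show u.length + 2 < 3 * m by omega)]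
          cases x <;> simp <;> tauto
    · have := mem_upd_comm h2
      simp only [Valid] at hn
      rcases h1 with rfl | rfl <;> simp only [nb, par, List.length_cons, List.tail_cons] <;>
        rw [if_neg (by omega)] <;> simp <;> tauto

/-- The distance to the root. -/
def depth : Node → ℕ
  | .o => 0
  | .L u => u.length + 1
  | .T u => u.length + 1
  | .B u => u.length + 2

lemma depth_par {m : ℕ} (hm : 1 ≤ m) {n : Node} (hn : n ≠ .o) :
    depth (par m n) + 1 = depth n := by
  rcases n with _ | (_ | ⟨x, u⟩) | (_ | ⟨x, u⟩) | u
  · exact absurd rfl hn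
  all_goals simp only [par, depth, List.length_cons, List.length_nil]
  split_ifs with h
  · rfl
  · rcases u with _ | ⟨x, u⟩
    · simp at h; omega
    · simp

lemma not_mem_nb_self {m : ℕ} (hm : 1 ≤ m) (n : Node) (z z' : Sheet m) : (n, z') ∉ nb m n z := by
  have key : ∀ n', n = par m n' → n = n' → n' = .o := by
    rintro n' h rfl
    by_contra hn
    have := depth_par hm hn
    rw [← h] at this
    omega
  rcases n with _ | u | u | u <;> simp only [nb]
  · simp
  · have := key (.L u); split_ifs <;> simp <;> intro h <;> exact absurd (this h rfl) (by simp)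
  · have := key (.T u); split_ifs <;> simp <;> intro h <;> exact absurd (this h rfl) (by simp)
  · have := key (.B u); split_ifs <;> simp <;> refine ⟨?_, ?_⟩ <;> intro h <;> simp [← h] at this

lemma nodup_nb {m : ℕ} (hm : 1 ≤ m) {n : Node} (hn : Valid m n) (z : Sheet m) :
    (nb m n z).Nodup := by
  have key : ∀ n', n ≠ .o → depth n' = depth n + 1 → par m n ≠ n' := by
    rintro n' hn h rfl
    have := depth_par hm hn
    omega
  rcases n with _ | u | u | u <;> simp only [nb]
  · simp
  · have h0 := key (.L (false :: u)) (by simp) rfl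
    have h1 := key (.L (true :: u)) (by simp) rfl
    split_ifs <;> simp [h0, h1]
  · have h0 := key (.T (false :: u)) (by simp) rfl
    have h1 := key (.T (true :: u)) (by simp) rfl
    have h2 := key (.B u) (by simp) rfl
    have := upd_false_ne_upd_true (show 0 < 2 * m by omega) z
    split_ifs <;> simp [h0, h1, h2, this]
  · have h0 := key (.B (false :: u)) (by simp) rfl
    have h1 := key (.B (true :: u)) (by simp) rfl
    simp only [Valid] at hn
    have := upd_false_ne_upd_true (show u.length + 1 - m < 2 * m by omega) z
    split_ifs
    · have h2 := upd_false_ne_upd_true (show u.length + 2 - m < 2 * m by omega) z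
      simp [h0, h1, h2, this]
    · simp [this]

end Lamp

namespace Lamp

/-- The path of a node, as a list of bits. -/
def path : Node → List Bool
  | .o => []
  | .L u => u
  | .T u => u
  | .B u => u

/-- The part of the base tree to which a node belongs. -/
def tag : Node → Fin 4
  | .o => 0
  | .L _ => 1
  | .T _ => 2
  | .B _ => 3

/-- An encoding that shows that there are finitely many nodes. -/
def code (m : ℕ) (n : {n // Valid m n}) : Fin 4 × (Fin (3 * m) → Option Bool) :=
  (tag n.1, fun i => (path n.1)[i.val]?)

lemma code_injective (m : ℕ) : Function.Injective (code m) := by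
  rintro ⟨n, hn⟩ ⟨n', hn'⟩ h
  have h1 : tag n = tag n' := congrArg Prod.fst h
  have hlen : ∀ n, Valid m n → (path n).length ≤ 3 * m := by
    rintro (_ | u | u | u) hn <;> simp only [Valid, path, List.length_nil] at hn ⊢ <;> omega
  have h2 : path n = path n' := by
    refine List.ext_getElem? fun i => ?_
    by_cases hi : i < 3 * m
    · exact congrFun (congrArg Prod.snd h) ⟨i, hi⟩
    · have := hlen n hn
      have := hlen n' hn'
      rw [List.getElem?_eq_none (by omega), List.getElem?_eq_none (by omega)]
  rcases n with _ | u | u | u <;> rcases n' with _ | u' | u' | u' <;>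
    simp [tag, path] at h1 h2 ⊢ <;> exact h2

instance (m : ℕ) : Fintype {n // Valid m n} := Fintype.ofInjective _ (code_injective m)

/-- The vertices of the cover. -/
abbrev Vert (m : ℕ) : Type := {n // Valid m n} × Sheet m

lemma card_vert_le (m : ℕ) : Fintype.card (Vert m) ≤ 4 * 3 ^ (3 * m) * 2 ^ (2 * m) := by
  have := Fintype.card_le_of_injective _ (code_injective m)
  simp only [Fintype.card_prod, Fintype.card_fin, Fintype.card_fun, Fintype.card_option,
    Fintype.card_bool] at this ⊢
  exact Nat.mul_le_mul_right _ this

/-- The vertex over the root in a given sheet. -/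
def root {m : ℕ} (z : Sheet m) : Vert m := (⟨.o, trivial⟩, z)

lemma le_card_vert (m : ℕ) : 2 ^ (2 * m) ≤ Fintype.card (Vert m) := by
  have := Fintype.card_le_of_injective (root (m := m)) fun z z' h => congrArg Prod.snd h
  simpa using this

instance (m : ℕ) : Nonempty (Vert m) := ⟨root fun _ => false⟩

/-- The cover, as a graph. -/
def cover (m : ℕ) (hm : 1 ≤ m) : SimpleGraph (Vert m) where
  Adj v w := (w.1.1, w.2) ∈ nb m v.1.1 v.2
  symm := ⟨fun v w h => mem_nb_symm v.1.2 w.1.2 h⟩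
  loopless := ⟨fun v h => not_mem_nb_self hm v.1.1 v.2 v.2 h⟩

/-- Sum over the neighbours of a vertex. -/
def nbSum {m : ℕ} (F : Node → Sheet m → ℝ) (n : Node) (z : Sheet m) : ℝ :=
  ((nb m n z).map fun x => F x.1 x.2).sum

variable {m : ℕ} {hm : 1 ≤ m}

open Classical in
lemma sum_adj (F : Node → Sheet m → ℝ) (v : Vert m) :
    (∑ u, if (cover m hm).Adj v u then F u.1.1 u.2 else 0) = nbSum F v.1.1 v.2 := by
  rw [nbSum, ← List.sum_toFinset _ (nodup_nb hm v.1.2 v.2), ← Finset.sum_filter]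
  refine Finset.sum_bij (fun u _ => (u.1.1, u.2)) ?_ ?_ ?_ ?_
  · intro u hu
    exact List.mem_toFinset.2 (Finset.mem_filter.1 hu).2
  · rintro ⟨⟨a, ha⟩, z⟩ _ ⟨⟨b, hb⟩, z'⟩ _ h
    simp only [Prod.mk.injEq] at h
    simp [h.1, h.2]
  · rintro ⟨n, z⟩ h
    rw [List.mem_toFinset] at h
    exact ⟨(⟨n, valid_of_mem_nb hm v.1.2 h⟩, z), Finset.mem_filter.2 ⟨Finset.mem_univ _, h⟩, rfl⟩
  · intro _ _; rfl

lemma deg_cover (v : Vert m) : deg (cover m hm) v = (nb m v.1.1 v.2).length := by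
  classical
  have := sum_adj (hm := hm) (fun _ _ => 1) v
  rw [Finset.sum_boole, ← deg_eq_card, nbSum] at this
  simpa using this

/-- The degree of the vertices over a node. -/
def dg (m : ℕ) : Node → ℕ
  | .o => 2
  | .L u => if u.length + 1 < 3 * m then 3 else 1
  | .T _ => 3
  | .B u => if u.length + 2 < 3 * m then 6 else 2

lemma length_nb (n : Node) (z : Sheet m) : (nb m n z).length = dg m n := by
  rcases n with _ | u | u | u <;> simp only [nb, dg] <;> try split_ifs
  all_goals simp

lemma dg_pos (n : Node) : 0 < dg m n := by
  rcases n with _ | u | u | u <;> simp only [dg] <;> try split_ifs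
  all_goals simp

lemma dg_le (n : Node) : dg m n ≤ 6 := by
  rcases n with _ | u | u | u <;> simp only [dg] <;> try split_ifs
  all_goals simp

lemma deg_cover_pos (v : Vert m) : 0 < deg (cover m hm) v := by
  rw [deg_cover, length_nb]; exact dg_pos _

/-- The transition operator, on functions on all nodes. -/
def stepOp {m : ℕ} (F : Node → Sheet m → ℝ) (n : Node) (z : Sheet m) : ℝ :=
  F n z / 2 + 1 / (2 * (dg m n : ℝ)) * nbSum F n z

lemma walkMat_cover_mulVec (F : Node → Sheet m → ℝ) (v : Vert m) :
    ((walkMat (cover m hm)).mulVec fun u => F u.1.1 u.2) v = stepOp F v.1.1 v.2 := by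
  classical
  rw [walkMat_mulVec, stepOp, ← sum_adj (hm := hm), deg_cover, length_nb]

/-- Extension by zero to all nodes. -/
def ext (f : Vert m → ℝ) (n : Node) (z : Sheet m) : ℝ :=
  open Classical in if h : Valid m n then f (⟨n, h⟩, z) else 0

lemma ext_apply (f : Vert m → ℝ) {n : Node} (h : Valid m n) (z : Sheet m) :
    ext f n z = f (⟨n, h⟩, z) := dif_pos h

lemma ext_mulVec (f : Vert m → ℝ) {n : Node} (hn : Valid m n) (z : Sheet m) :
    ext ((walkMat (cover m hm)).mulVec f) n z = stepOp (ext f) n z := by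
  have : f = fun u => ext f u.1.1 u.2 := funext fun u => (ext_apply f u.1.2 u.2).symm
  rw [ext_apply _ hn]
  conv_lhs => rw [this]
  exact walkMat_cover_mulVec _ _

/-- Average over the two values of a bit. -/
def av (i : ℕ) (g : Sheet m → ℝ) (z : Sheet m) : ℝ := (g (upd z i false) + g (upd z i true)) / 2

section stepOp

variable (F : Node → Sheet m → ℝ) (z : Sheet m)

lemma stepOp_o : stepOp F .o z = F .o z / 2 + (F (.L []) z + F (.T []) z) / 4 := by
  simp [stepOp, nbSum, nb, dg]; ring

lemma stepOp_L {u : List Bool} (h : u.length + 1 < 3 * m) : stepOp F (.L u) z =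
    F (.L u) z / 2 + (F (par m (.L u)) z + F (.L (false :: u)) z + F (.L (true :: u)) z) / 6 := by
  simp [stepOp, nbSum, nb, dg, h]; ring

lemma stepOp_L_leaf {u : List Bool} (h : ¬ u.length + 1 < 3 * m) : stepOp F (.L u) z =
    F (.L u) z / 2 + F (par m (.L u)) z / 2 := by
  simp [stepOp, nbSum, nb, dg, h]; ring

lemma stepOp_T {u : List Bool} (h : u.length + 1 < m) : stepOp F (.T u) z =
    F (.T u) z / 2 + (F (par m (.T u)) z + F (.T (false :: u)) z + F (.T (true :: u)) z) / 6 := by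
  simp [stepOp, nbSum, nb, dg, h]; ring

lemma stepOp_T_last {u : List Bool} (h : ¬ u.length + 1 < m) : stepOp F (.T u) z =
    F (.T u) z / 2 + (F (par m (.T u)) z + 2 * av 0 (F (.B u)) z) / 6 := by
  simp [stepOp, nbSum, nb, dg, h, av]; ring

lemma stepOp_B {u : List Bool} (h : u.length + 2 < 3 * m) : stepOp F (.B u) z =
    F (.B u) z / 2 + (av (u.length + 1 - m) (F (par m (.B u))) z +
      av (u.length + 2 - m) (F (.B (false :: u))) z +
      av (u.length + 2 - m) (F (.B (true :: u))) z) / 6 := by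
  simp [stepOp, nbSum, nb, dg, h, av]; ring

lemma stepOp_B_leaf {u : List Bool} (h : ¬ u.length + 2 < 3 * m) : stepOp F (.B u) z =
    F (.B u) z / 2 + av (u.length + 1 - m) (F (par m (.B u))) z / 2 := by
  simp [stepOp, nbSum, nb, dg, h, av]; ring

end stepOp

end Lamp

namespace Lamp

variable {m : ℕ} {hm : 1 ≤ m}

/-! ### Comparison for the transition operator -/

lemma stepOp_affine (F : Node → Sheet m → ℝ) (a b : ℝ) (n : Node) (z : Sheet m) :
    stepOp (fun n z => a + b * F n z) n z = a + b * stepOp F n z := by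
  have : ∀ l : List (Node × Sheet m), (l.map fun x => a + b * F x.1 x.2).sum =
      l.length * a + b * (l.map fun x => F x.1 x.2).sum := by
    intro l
    induction l with
    | nil => simp
    | cons x l ih => simp only [List.map_cons, List.sum_cons, ih, List.length_cons]; push_cast; ring
  simp only [stepOp, nbSum, this, length_nb]
  have : (dg m n : ℝ) ≠ 0 := by exact_mod_cast (dg_pos n).ne'
  field_simp
  ring

lemma abs_stepOp_le (hm : 1 ≤ m) {F W : Node → Sheet m → ℝ}
    (h : ∀ n, Valid m n → ∀ z, |F n z| ≤ W n z)
    {n : Node} (hn : Valid m n) (z : Sheet m) : |stepOp F n z| ≤ stepOp W n z := by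
  have : ∀ l : List (Node × Sheet m), (∀ x ∈ l, Valid m x.1) →
      |(l.map fun x => F x.1 x.2).sum| ≤ (l.map fun x => W x.1 x.2).sum := by
    intro l hl
    induction l with
    | nil => simp
    | cons x l ih =>
      simp only [List.map_cons, List.sum_cons]
      exact (abs_add_le _ _).trans (add_le_add (h _ (hl x (by simp)) _)
        (ih fun y hy => hl y (by simp [hy])))
  have h1 := this (nb m n z) fun x hx => valid_of_mem_nb hm hn hx
  refine (abs_add_le _ _).trans (add_le_add ?_ ?_)
  · rw [abs_div, abs_two]
    exact div_le_div_of_nonneg_right (h n hn z) two_pos.le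
  · rw [abs_mul, abs_of_nonneg (by positivity)]
    exact mul_le_mul_of_nonneg_left h1 (by positivity)

/-- A solution of the heat equation that is small on a target is small everywhere after a time
comparable to a potential `W` that bounds the hitting time of the target. -/
lemma abs_le_of_potential (hm : 1 ≤ m) {Ψ : ℕ → Node → Sheet m → ℝ}
    (hΨ : ∀ s n, Valid m n → ∀ z, Ψ (s + 1) n z = stepOp (Ψ s) n z)
    (h0 : ∀ n, Valid m n → ∀ z, |Ψ 0 n z| ≤ 2) {T : Node → Prop} {ε : ℝ} (hε : 0 ≤ ε)
    (hT : ∀ s n, Valid m n → T n → ∀ z, |Ψ s n z| ≤ ε) {W : Node → ℝ} {K : ℝ} (hK : 1 ≤ K)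
    (hW0 : ∀ n, Valid m n → 0 ≤ W n) (hWK : ∀ n, Valid m n → W n ≤ K)
    (hW : ∀ n, Valid m n → ¬ T n → ∀ z : Sheet m, stepOp (fun n _ => W n) n z ≤ W n - 1)
    {s : ℕ} (hs : 8 * K ≤ s) {n : Node} (hn : Valid m n) (z : Sheet m) :
    |Ψ s n z| ≤ ε + 1 / 6 := by
  have hK0 : 0 < K := by linarith
  set l : ℝ := 1 - 1 / (2 * K) with hl
  have hl0 : 0 ≤ l := by
    have : 1 / (2 * K) ≤ 1 := by rw [div_le_one (by positivity)]; linarith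
    linarith
  have key : ∀ s n, Valid m n → ∀ z, |Ψ s n z| ≤ ε + 2 * l ^ s * (1 + W n / K) := by
    intro s
    induction s with
    | zero =>
      intro n hn z
      have := div_nonneg (hW0 n hn) hK0.le
      have := h0 n hn z
      simp only [pow_zero]
      linarith
    | succ s ih =>
      intro n hn z
      by_cases hTn : T n
      · have := div_nonneg (hW0 n hn) hK0.le
        have := hT (s + 1) n hn hTn z
        have : 0 ≤ 2 * l ^ (s + 1) * (1 + W n / K) := by positivity
        linarith
      · rw [hΨ s n hn]
        refine (abs_stepOp_le hm ih hn z).trans ?_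
        have e : (fun (n : Node) (_ : Sheet m) => ε + 2 * l ^ s * (1 + W n / K)) =
            fun n _ => (ε + 2 * l ^ s) + (2 * l ^ s / K) * W n := by
          funext n _; ring
        rw [e, stepOp_affine (fun n _ => W n)]
        have h1 := mul_le_mul_of_nonneg_left (hW n hn hTn z)
          (show 0 ≤ 2 * l ^ s / K by positivity)
        have h2 : (1 + W n / K) - 1 / K ≤ l * (1 + W n / K) := by
          have : W n / K ≤ 1 := (div_le_one hK0).2 (hWK n hn)
          have h3 : 0 ≤ 1 / (2 * K) := by positivity
          have h4 : 1 / K = 2 * (1 / (2 * K)) := by field_simp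
          rw [hl, h4]
          nlinarith
        have h5 := mul_le_mul_of_nonneg_left h2 (show 0 ≤ 2 * l ^ s by positivity)
        have h6 : 2 * l ^ s / K * (W n - 1) = 2 * l ^ s * (W n / K - 1 / K) := by ring
        rw [h6] at h1
        rw [pow_succ]
        linarith
  refine (key s n hn z).trans ?_
  have h1 : l ^ s ≤ Real.exp (-4) := by
    have h2 : l ≤ Real.exp (-(1 / (2 * K))) := by
      have := Real.add_one_le_exp (-(1 / (2 * K)))
      linarith
    calc l ^ s ≤ Real.exp (-(1 / (2 * K))) ^ s := by gcongr
      _ = Real.exp (-(s / (2 * K))) := by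
        rw [← Real.exp_nat_mul]; congr 1; ring
      _ ≤ Real.exp (-4) := by
        gcongr
        rw [le_div_iff₀ (by positivity)]
        linarith
  have h3 : Real.exp (-4) ≤ 1 / 24 := by
    rw [Real.exp_neg, ← one_div]
    have : Real.exp 4 = Real.exp 1 ^ 4 := by rw [← Real.exp_nat_mul]; norm_num
    rw [this]
    have h4 : (2.7 : ℝ) ≤ Real.exp 1 := by linarith [Real.exp_one_gt_d9]
    have h5 : (2.7 : ℝ) ^ 4 ≤ Real.exp 1 ^ 4 := by gcongr
    exact one_div_le_one_div_of_le (by norm_num) (by norm_num at h5 ⊢; linarith)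
  have h4 : W n / K ≤ 1 := (div_le_one hK0).2 (hWK n hn)
  have h5 := div_nonneg (hW0 n hn) hK0.le
  have h6 : 0 ≤ l ^ s := by positivity
  nlinarith

/-! ### Potentials depending on the level only -/

/-- The function on nodes given by functions of the depth on the left and on the right. -/
def lv (a b : ℕ → ℝ) : Node → ℝ
  | .o => b 0
  | .L u => a (u.length + 1)
  | .T u => b (u.length + 1)
  | .B u => b (u.length + 2)

lemma lv_par_L {a b : ℕ → ℝ} (h : a 0 = b 0) (u : List Bool) : lv a b (par m (.L u)) = a u.length := by
  cases u <;> simp [par, lv, h]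

lemma lv_par_T (a b : ℕ → ℝ) (u : List Bool) : lv a b (par m (.T u)) = b u.length := by
  cases u <;> simp [par, lv]

lemma lv_par_B (hm : 1 ≤ m) (a b : ℕ → ℝ) (u : List Bool) :
    lv a b (par m (.B u)) = b (u.length + 1) := by
  simp only [par]
  split_ifs with h
  · rfl
  · cases u
    · simp at h; omega
    · simp [lv]

lemma stepOp_lv_o (a b : ℕ → ℝ) (z : Sheet m) :
    stepOp (fun n _ => lv a b n) .o z = b 0 / 2 + (a 1 + b 1) / 4 := by
  simp [stepOp_o, lv]

lemma stepOp_lv (hm : 1 ≤ m) {a b : ℕ → ℝ} (h : a 0 = b 0) {R : ℝ → ℝ → Prop}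
    (ha : ∀ j, j + 1 < 3 * m → R (a (j + 1) / 2 + (a j + 2 * a (j + 2)) / 6) (a (j + 1)))
    (ha' : ∀ j, j + 1 = 3 * m → R (a (j + 1) / 2 + a j / 2) (a (j + 1)))
    (hb : ∀ j, j + 1 < 3 * m → R (b (j + 1) / 2 + (b j + 2 * b (j + 2)) / 6) (b (j + 1)))
    {n : Node} (hn : Valid m n) (hno : n ≠ .o)
    (hb' : (∀ u, n = .B u → u.length + 2 < 3 * m) ∨
      ∀ j, j + 1 = 3 * m → R (b (j + 1) / 2 + b j / 2) (b (j + 1))) (z : Sheet m) :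
    R (stepOp (fun n _ => lv a b n) n z) (lv a b n) := by
  rcases n with _ | u | u | u <;> simp only [Valid] at hn
  · exact absurd rfl hno
  · by_cases hu : u.length + 1 < 3 * m
    · have e : stepOp (fun n (_ : Sheet m) => lv a b n) (.L u) z =
          a (u.length + 1) / 2 + (a u.length + 2 * a (u.length + 2)) / 6 := by
        rw [stepOp_L _ _ hu, lv_par_L h]
        simp [lv]; ring
      rw [e]; exact ha _ hu
    · have e : stepOp (fun n (_ : Sheet m) => lv a b n) (.L u) z =
          a (u.length + 1) / 2 + a u.length / 2 := by
        rw [stepOp_L_leaf _ _ hu, lv_par_L h]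
        simp [lv]
      rw [e]; exact ha' _ (by omega)
  · have e : stepOp (fun n (_ : Sheet m) => lv a b n) (.T u) z =
        b (u.length + 1) / 2 + (b u.length + 2 * b (u.length + 2)) / 6 := by
      by_cases hu : u.length + 1 < m
      · rw [stepOp_T _ _ hu, lv_par_T]
        simp [lv]; ring
      · rw [stepOp_T_last _ _ hu, lv_par_T]
        simp [lv, av]
    rw [e]; exact hb _ (by omega)
  · by_cases hu : u.length + 2 < 3 * m
    · have e : stepOp (fun n (_ : Sheet m) => lv a b n) (.B u) z =
          b (u.length + 2) / 2 + (b (u.length + 1) + 2 * b (u.length + 3)) / 6 := by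
        rw [stepOp_B _ _ hu]
        simp [av, lv_par_B hm]
        simp [lv]; ring
      rw [e]; exact hb _ hu
    · rcases hb' with hb' | hb'
      · exact absurd (hb' u rfl) hu
      have e : stepOp (fun n (_ : Sheet m) => lv a b n) (.B u) z =
          b (u.length + 2) / 2 + b (u.length + 1) / 2 := by
        rw [stepOp_B_leaf _ _ hu]
        simp [av, lv_par_B hm]
        simp [lv]
      rw [e]; exact hb' _ (by omega)

lemma lv_prop (hm : 1 ≤ m) {a b : ℕ → ℝ} {R : ℝ → Prop} (ha : ∀ j ≤ 3 * m, R (a j))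
    (hb : ∀ j ≤ 3 * m, R (b j)) {n : Node} (hn : Valid m n) : R (lv a b n) := by
  rcases n with _ | u | u | u <;> simp only [Valid] at hn
  exacts [hb _ (by omega), ha _ (by omega), hb _ (by omega), hb _ (by omega)]

/-- The expected hitting time of the root from depth `j` in a tree of depth `d`. -/
def hit (d j : ℕ) : ℝ := 8 * 2 ^ d * (1 - (1 / 2) ^ j) - 6 * j

lemma hit_zero (d : ℕ) : hit d 0 = 0 := by simp [hit]

lemma hit_step (d j : ℕ) :
    hit d (j + 1) / 2 + (hit d j + 2 * hit d (j + 2)) / 6 = hit d (j + 1) - 1 := by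
  simp only [hit, pow_succ]; push_cast; ring

lemma hit_leaf {d j : ℕ} (h : j + 1 = d) : hit d (j + 1) / 2 + hit d j / 2 = hit d (j + 1) - 1 := by
  subst h
  have : (2 : ℝ) ^ j * (1 / 2) ^ j = 1 := by rw [← mul_pow]; norm_num
  simp only [hit, pow_succ]; push_cast
  linear_combination -4 * this

lemma hit_nonneg {d j : ℕ} (h : j ≤ d) : 0 ≤ hit d j := by
  obtain ⟨i, rfl⟩ := Nat.exists_eq_add_of_le h
  have h1 : (2 : ℝ) ^ j * (1 / 2) ^ j = 1 := by rw [← mul_pow]; norm_num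
  have h2 : hit (j + i) j = 8 * 2 ^ i * (2 ^ j - 1) - 6 * j := by
    simp only [hit, pow_add]; linear_combination -8 * 2 ^ i * h1
  have h3 : (1 : ℝ) ≤ 2 ^ i := one_le_pow₀ (by norm_num)
  have h4 : (1 : ℝ) + j * 1 ≤ 2 ^ j := by
    have := one_add_mul_le_pow (a := (1 : ℝ)) (by norm_num) j
    norm_num at this ⊢; linarith
  have h5 : (0 : ℝ) ≤ j := Nat.cast_nonneg j
  rw [h2]
  nlinarith [mul_le_mul h3 h4 (by linarith) (by linarith)]

lemma hit_le (d j : ℕ) : hit d j ≤ 8 * 2 ^ d := by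
  have h1 : (0 : ℝ) ≤ (1 / 2) ^ j := by positivity
  have h2 : (0 : ℝ) ≤ 2 ^ d := by positivity
  have h3 : (0 : ℝ) ≤ j := Nat.cast_nonneg j
  simp only [hit]
  nlinarith [mul_nonneg h1 h2]

/-- A bound for the hitting time of the right leaves from the right. -/
def hitR (d j : ℕ) : ℝ := 16 * 2 ^ d * (1 / 2) ^ j + 6 * (d - j)

/-- A bound for the hitting time of the right leaves from the left. -/
def hitL (d j : ℕ) : ℝ := 16 * 2 ^ d + 6 * d + hit d j

lemma hitR_step (d j : ℕ) :
    hitR d (j + 1) / 2 + (hitR d j + 2 * hitR d (j + 2)) / 6 = hitR d (j + 1) - 1 := by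
  simp only [hitR, pow_succ]; push_cast; ring

end Lamp

/-- If `P h = h + f`, the energy of `P ^ n f` is at most `(-⟪f, h⟫) / n`. -/
lemma mul_wInner_pow_le {P : Matrix V V ℝ} {π : V → ℝ} (hP : IsStoch P) (hπ : ∀ x, 0 ≤ π x)
    (hr : Rev P π) (hl : ∀ x, 1 / 2 ≤ P x x) {f h : V → ℝ} (hf : P.mulVec h = h + f) (n : ℕ) :
    n * wInner π ((P ^ n).mulVec f) ((P ^ n).mulVec f) ≤ - wInner π f h := by
  have hadd : ∀ f g g' : V → ℝ, wInner π f (g + g') = wInner π f g + wInner π f g' := by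
    intro f g g'
    simp only [wInner, Pi.add_apply, ← Finset.sum_add_distrib]
    exact Finset.sum_congr rfl fun x _ => by ring
  have hstep : ∀ t, wInner π f ((P ^ (t + 1)).mulVec h) =
      wInner π f ((P ^ t).mulVec h) + wInner π f ((P ^ t).mulVec f) := by
    intro t
    rw [pow_add_mulVec, pow_one, hf, Matrix.mulVec_add, hadd]
  have heven : ∀ k (g g' : V → ℝ), wInner π g ((P ^ (2 * k)).mulVec g') =
      wInner π ((P ^ k).mulVec g) ((P ^ k).mulVec g') := by
    intro k g g'
    rw [two_mul, pow_add_mulVec, wInner_pow_mulVec hr]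
  have hodd : ∀ k, 0 ≤ wInner π f ((P ^ (2 * k + 1)).mulVec f) := by
    intro k
    rw [show 2 * k + 1 = k + (1 + k) by ring, pow_add_mulVec, wInner_pow_mulVec hr,
      pow_add_mulVec, pow_one]
    exact wInner_mulVec_nonneg hP hπ hr hl _
  have key : n * wInner π ((P ^ n).mulVec f) ((P ^ n).mulVec f) ≤
      wInner π f ((P ^ (2 * n)).mulVec h) - wInner π f h := by
    induction n with
    | zero => simp
    | succ n ih =>
      have h1 : wInner π ((P ^ (n + 1)).mulVec f) ((P ^ (n + 1)).mulVec f) ≤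
          wInner π ((P ^ n).mulVec f) ((P ^ n).mulVec f) := by
        rw [pow_succ_mulVec]
        exact wInner_mulVec_self_le hP hπ hr hl _
      have h2 := hodd n
      have h3 := heven n f f
      have h4 := mul_le_mul_of_nonneg_left h1 (show (0 : ℝ) ≤ n + 1 by positivity)
      rw [show 2 * (n + 1) = 2 * n + 1 + 1 by ring, hstep, hstep]
      push_cast
      linarith
  have hlast : wInner π f ((P ^ (2 * n)).mulVec h) ≤ 0 := by
    have h1 : f = P.mulVec h - h := by rw [hf]; abel
    have h2 := wInner_mulVec_le hP hπ hr ((P ^ n).mulVec h)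
    have h3 : (P ^ n).mulVec f = P.mulVec ((P ^ n).mulVec h) - (P ^ n).mulVec h := by
      rw [h1, Matrix.mulVec_sub, ← pow_succ_mulVec, pow_succ, ← Matrix.mulVec_mulVec]
    have h4 := hadd ((P ^ n).mulVec h) ((P ^ n).mulVec f) ((P ^ n).mulVec h)
    rw [h3, sub_add_cancel] at h4
    rw [heven, wInner_comm, h3]
    linarith
  linarith

namespace Lamp

variable {m : ℕ} {hm : 1 ≤ m}

/-- The potential of the root. -/
def hv (v : Vert m) : ℝ := lv (hit (3 * m)) (hit (3 * m)) v.1.1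

open Classical in
/-- The charge of the potential of the root. -/
def charge (v : Vert m) : ℝ := if v.1.1 = .o then hit (3 * m) 1 / 2 else -1

lemma stepOp_hit (hm : 1 ≤ m) {n : Node} (hn : Valid m n) (hno : n ≠ .o) (z : Sheet m) :
    stepOp (fun n _ => lv (hit (3 * m)) (hit (3 * m)) n) n z =
      lv (hit (3 * m)) (hit (3 * m)) n - 1 :=
  stepOp_lv hm rfl (R := fun x y => x = y - 1) (fun _ _ => hit_step _ _) (fun _ h => hit_leaf h)
    (fun _ _ => hit_step _ _) hn hno (Or.inr fun _ h => hit_leaf h) z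

lemma mulVec_hv : (walkMat (cover m hm)).mulVec hv = hv + charge := by
  funext v
  refine (walkMat_cover_mulVec (fun n _ => lv (hit (3 * m)) (hit (3 * m)) n) v).trans ?_
  by_cases h : v.1.1 = .o
  · rw [h, stepOp_lv_o, Pi.add_apply, charge, if_pos h, hv, h]
    simp [lv, hit_zero]; ring
  · rw [stepOp_hit hm v.1.2 h, Pi.add_apply, charge, if_neg h, hv, sub_eq_add_neg]

lemma hv_le (hm : 1 ≤ m) (v : Vert m) : hv v ≤ 8 * 2 ^ (3 * m) :=
  lv_prop hm (R := fun x => x ≤ 8 * 2 ^ (3 * m)) (fun _ _ => hit_le _ _) (fun _ _ => hit_le _ _) v.1.2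

lemma neg_wInner_charge_hv_le :
    - wInner (degSta (cover m hm)) charge hv ≤ 8 * 2 ^ (3 * m) := by
  have hπ := isProb_degSta (G := cover m hm) deg_cover_pos
  have h1 : - wInner (degSta (cover m hm)) charge hv = ∑ v, degSta (cover m hm) v * hv v := by
    rw [wInner, ← Finset.sum_neg_distrib]
    refine Finset.sum_congr rfl fun v _ => ?_
    by_cases h : v.1.1 = .o
    · simp [hv, h, lv, hit_zero]
    · simp [charge, h]
  rw [h1]
  calc _ ≤ ∑ v, degSta (cover m hm) v * (8 * 2 ^ (3 * m)) := 
        Finset.sum_le_sum fun v _ => mul_le_mul_of_nonneg_left (hv_le hm v) (hπ.1 v).le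
    _ = _ := by rw [← Finset.sum_mul, hπ.2, one_mul]

/-- The average of a function over the sheets. -/
def avg (g : Sheet m → ℝ) : ℝ := (∑ z, g z) / 2 ^ (2 * m)

lemma degSta_root (z z' : Sheet m) : degSta (cover m hm) (root z) = degSta (cover m hm) (root z') := by
  simp only [degSta, deg_cover, root, length_nb]

lemma wInner_charge (g : Vert m → ℝ) : wInner (degSta (cover m hm)) charge g =
    avg (fun z => g (root z)) - ∑ v, degSta (cover m hm) v * g v := by
  classical
  have hG : ∀ v, 0 < deg (cover m hm) v := deg_cover_pos
  have hπ := isProb_degSta hG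
  set q := degSta (cover m hm) (root fun _ => false) with hq
  set κ := hit (3 * m) 1 / 2 with hκ
  have key : ∀ g : Vert m → ℝ, wInner (degSta (cover m hm)) charge g =
      (κ + 1) * q * ∑ z, g (root z) - ∑ v, degSta (cover m hm) v * g v := by
    intro g
    have h1 : ∀ v : Vert m, degSta (cover m hm) v * (charge v * g v) =
        (κ + 1) * q * (if v.1.1 = .o then g v else 0) - degSta (cover m hm) v * g v := by
      intro v
      by_cases h : v.1.1 = .o
      · have : v = root v.2 := by
          obtain ⟨⟨n, hn⟩, z⟩ := v
          subst h; rfl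
        rw [charge, if_pos h, if_pos h, this, degSta_root _ fun _ => false]
        ring
      · rw [charge, if_neg h, if_neg h]; ring
    rw [wInner, Finset.sum_congr rfl fun v _ => h1 v, Finset.sum_sub_distrib, ← Finset.mul_sum]
    congr 2
    rw [← Finset.sum_filter]
    symm
    refine Finset.sum_bij (fun z _ => root z) ?_ ?_ ?_ ?_
    · intro z _; simp [root]
    · intro z _ z' _ h; exact congrArg Prod.snd h
    · rintro ⟨⟨n, hn⟩, z⟩ h
      simp only [Finset.mem_filter, Finset.mem_univ, true_and] at h
      subst h
      exact ⟨z, Finset.mem_univ _, rfl⟩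
    · intros; rfl
  have h0 : wInner (degSta (cover m hm)) charge (fun _ => 1) = 0 := by
    have h1 := sum_mulVec (isStoch_walkMat hG) (rev_walkMat hG) hv
    rw [mulVec_hv] at h1
    simp only [Pi.add_apply, mul_add, Finset.sum_add_distrib] at h1
    simp only [wInner, mul_one]
    linarith
  rw [key] at h0
  simp only [mul_one, hπ.2, Finset.sum_const, Finset.card_univ, Fintype.card_fun,
    Fintype.card_bool, Fintype.card_fin, nsmul_eq_mul] at h0
  push_cast at h0
  rw [key, avg]
  congr 1
  field_simp
  linear_combination (∑ z, g (root z)) * h0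

/-- The average over the fibre of the root is close to equilibrium. -/
lemma abs_avg_root_le {F : Vert m → ℝ} (hF : ∀ v, |F v| ≤ 1) {t : ℕ}
    (ht : 288 * 2 ^ (3 * m) ≤ t) :
    |avg (fun z => ((walkMat (cover m hm) ^ t).mulVec F) (root z)) -
      ∑ v, degSta (cover m hm) v * F v| ≤ 1 / 6 := by
  have hG : ∀ v, 0 < deg (cover m hm) v := deg_cover_pos
  have hπ := isProb_degSta hG
  have hP := isStoch_walkMat hG
  have hr := rev_walkMat hG
  have h0 : ∀ v, 0 ≤ degSta (cover m hm) v := fun v => (hπ.1 v).le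
  rw [← sum_pow_mulVec hP hr F t, ← wInner_charge, wInner_pow_mulVec hr]
  have h1 := mul_wInner_pow_le hP h0 hr half_le_walkMat mulVec_hv t
  have h2 := neg_wInner_charge_hv_le (m := m) (hm := hm)
  have h3 := wInner_sq_le h0 ((walkMat (cover m hm) ^ t).mulVec charge) F
  have h4 : wInner (degSta (cover m hm)) F F ≤ 1 := by
    rw [← hπ.2]
    refine Finset.sum_le_sum fun v _ => ?_
    have : F v * F v ≤ 1 := by
      have := abs_le.1 (hF v)
      nlinarith
    have := mul_le_mul_of_nonneg_left this (h0 v)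
    linarith
  set b := wInner (degSta (cover m hm)) ((walkMat (cover m hm) ^ t).mulVec charge)
    ((walkMat (cover m hm) ^ t).mulVec charge) with hb
  have hb0 : 0 ≤ b := wInner_self_nonneg h0 _
  have hb1 : b ≤ 1 / 36 := by
    have h5 : (0 : ℝ) < 2 ^ (3 * m) := by positivity
    have h6 : (288 * 2 ^ (3 * m) : ℝ) * b ≤ 8 * 2 ^ (3 * m) := by
      have : (288 * 2 ^ (3 * m) : ℝ) ≤ t := by exact_mod_cast ht
      linarith [mul_le_mul_of_nonneg_right this hb0]
    by_contra! hlt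
    nlinarith
  refine abs_le_of_sq_le_sq (h3.trans ?_) (by norm_num)
  have := mul_le_mul hb1 h4 (wInner_self_nonneg h0 _) (by norm_num)
  linarith

end Lamp

namespace Lamp

variable {m : ℕ} {hm : 1 ≤ m}

/-! ### Averaging over the unresolved bits of the sheet -/

/-- The sheet that agrees with `z` on the first `i` bits and with `z'` on the others. -/
def merge (i : ℕ) (z z' : Sheet m) : Sheet m := fun j => if j.val < i then z j else z' j

/-- Average over all bits but the first `i`. -/
def avT (i : ℕ) (g : Sheet m → ℝ) (z : Sheet m) : ℝ := avg fun z' => g (merge i z z')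

lemma avT_zero (g : Sheet m → ℝ) (z : Sheet m) : avT 0 g z = avg g := by
  have : ∀ z', merge 0 z z' = z' := fun z' => by funext j; simp [merge]
  simp [avT, this]

lemma avT_top {i : ℕ} (hi : 2 * m ≤ i) (g : Sheet m → ℝ) (z : Sheet m) : avT i g z = g z := by
  have : ∀ z', merge i z z' = z := fun z' => by
    funext j; simp [merge, show j.val < i by have := j.2; omega]
  simp [avT, avg, this]

lemma avg_add (g g' : Sheet m → ℝ) : avg (fun z => g z + g' z) = avg g + avg g' := by
  simp [avg, Finset.sum_add_distrib, add_div]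

lemma avg_mul (c : ℝ) (g : Sheet m → ℝ) : avg (fun z => c * g z) = c * avg g := by
  simp [avg, ← Finset.mul_sum, mul_div_assoc]

lemma avT_add (i : ℕ) (g g' : Sheet m → ℝ) (z : Sheet m) :
    avT i (fun z => g z + g' z) z = avT i g z + avT i g' z := avg_add _ _

lemma avT_mul (i : ℕ) (c : ℝ) (g : Sheet m → ℝ) (z : Sheet m) :
    avT i (fun z => c * g z) z = c * avT i g z := avg_mul _ _

lemma abs_avT_le {g : Sheet m → ℝ} {M : ℝ} (h : ∀ z, |g z| ≤ M) (i : ℕ) (z : Sheet m) :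
    |avT i g z| ≤ M := by
  rw [avT, avg, abs_div, abs_of_pos (show (0 : ℝ) < 2 ^ (2 * m) by positivity),
    div_le_iff₀ (by positivity)]
  refine (Finset.abs_sum_le_sum_abs _ _).trans ((Finset.sum_le_sum fun z' _ => h _).trans ?_)
  simp [mul_comm]

lemma avg_av (i : ℕ) (G : Sheet m → ℝ) : avg (av i G) = avg G := by
  by_cases hi : i < 2 * m
  · let e : Sheet m ≃ Sheet m :=
      { toFun := fun z => upd z i (! z ⟨i, hi⟩)
        invFun := fun z => upd z i (! z ⟨i, hi⟩)
        left_inv := fun z => by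
          funext j; simp only [upd]; split_ifs with h
          · subst h; simp
          · rfl
        right_inv := fun z => by
          funext j; simp only [upd]; split_ifs with h
          · subst h; simp
          · rfl }
    have h1 : ∀ z, av i G z = (G z + G (e z)) / 2 := by
      intro z
      have : upd z i (z ⟨i, hi⟩) = z := by
        funext j; simp only [upd]; split_ifs with h
        · subst h; rfl
        · rfl
      change _ = (G z + G (upd z i (! z ⟨i, hi⟩))) / 2
      cases hz : z ⟨i, hi⟩ <;> rw [hz] at this <;> rw [av, this] <;> simp [add_comm]
    simp only [avg, h1, ← Finset.sum_div, Finset.sum_add_distrib, Equiv.sum_comp e G]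
    ring
  · have : ∀ (z : Sheet m) b, upd z i b = z := fun z b => by
      funext j; simp [upd, show j.val ≠ i by have := j.2; omega]
    simp [avg, av, this]

lemma upd_merge (i : ℕ) (z z' : Sheet m) (b : Bool) :
    upd (merge i z z') i b = merge i z (upd z' i b) := by
  funext j; simp only [upd, merge]; split_ifs <;> first | rfl | omega

lemma upd_merge_succ (i : ℕ) (z z' : Sheet m) (b : Bool) :
    upd (merge (i + 1) z z') i b = upd (merge i z z') i b := by
  funext j; simp only [upd, merge]; split_ifs <;> first | rfl | omega

lemma merge_upd (i : ℕ) (z z' : Sheet m) (b : Bool) :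
    merge i (upd z i b) z' = merge i z z' := by
  funext j; simp only [upd, merge]; split_ifs <;> first | rfl | omega

lemma merge_succ_upd (i : ℕ) (z z' : Sheet m) (b : Bool) :
    merge (i + 1) (upd z i b) z' = upd (merge i z z') i b := by
  funext j; simp only [upd, merge]; split_ifs <;> first | rfl | omega

lemma avT_av (i : ℕ) (g : Sheet m → ℝ) (z : Sheet m) : avT i (av i g) z = avT i g z := by
  rw [avT, avT, ← avg_av i fun z' => g (merge i z z')]
  congr 1
  funext z'
  simp only [av, upd_merge]

lemma avT_succ_av (i : ℕ) (g : Sheet m → ℝ) (z : Sheet m) :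
    avT (i + 1) (av i g) z = avT i g z := by
  rw [← avT_av i, avT, avT]
  simp only [av, upd_merge_succ]

lemma av_avT (i : ℕ) (g : Sheet m → ℝ) (z : Sheet m) : av i (avT i g) z = avT i g z := by
  simp only [av, avT, merge_upd]; ring

lemma av_avT_succ (i : ℕ) (g : Sheet m → ℝ) (z : Sheet m) :
    av i (avT (i + 1) g) z = avT i g z := by
  rw [← avT_av]
  simp only [av, avT, merge_succ_upd, avg, Finset.sum_add_distrib, ← Finset.sum_div]
  ring

/-- The number of bits resolved at a node. -/
def idx (m : ℕ) : Node → ℕ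
  | .o => 0
  | .L _ => 0
  | .T _ => 0
  | .B u => u.length + 2 - m

lemma idx_par_L (u : List Bool) : idx m (par m (.L u)) = 0 := by
  cases u <;> rfl

lemma idx_par_T (u : List Bool) : idx m (par m (.T u)) = 0 := by
  cases u <;> rfl

lemma idx_par_B {u : List Bool} (h : Valid m (.B u)) :
    idx m (par m (.B u)) = u.length + 1 - m := by
  simp only [Valid] at h
  simp only [par]
  split_ifs with hu
  · simp only [idx]; omega
  · simp only [idx, List.length_tail]; omega

/-- Averaging over the unresolved bits commutes with the walk. -/
lemma avT_stepOp (F : Node → Sheet m → ℝ) {n : Node} (hn : Valid m n) (z : Sheet m) :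
    avT (idx m n) (stepOp F n) z = stepOp (fun n' => avT (idx m n') (F n')) n z := by
  rcases n with _ | u | u | u
  · have h : stepOp F .o = fun z => (1 / 2 * F .o z) + (1 / 4 * F (.L []) z + 1 / 4 * F (.T []) z) := by
      funext z; rw [stepOp_o]; ring
    rw [stepOp_o, h, avT_add, avT_add, avT_mul, avT_mul, avT_mul]
    simp only [idx]; ring
  · by_cases hu : u.length + 1 < 3 * m
    · have h : stepOp F (.L u) = fun z => (1 / 2 * F (.L u) z) + (1 / 6 * F (par m (.L u)) z +
          (1 / 6 * F (.L (false :: u)) z + 1 / 6 * F (.L (true :: u)) z)) := by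
        funext z; rw [stepOp_L _ _ hu]; ring
      rw [stepOp_L _ _ hu, h]
      simp only [avT_add, avT_mul, idx_par_L]; simp only [idx]; ring
    · have h : stepOp F (.L u) = fun z => (1 / 2 * F (.L u) z) + (1 / 2 * F (par m (.L u)) z) := by
        funext z; rw [stepOp_L_leaf _ _ hu]; ring
      rw [stepOp_L_leaf _ _ hu, h]
      simp only [avT_add, avT_mul, idx_par_L]; simp only [idx]; ring
  · by_cases hu : u.length + 1 < m
    · have h : stepOp F (.T u) = fun z => (1 / 2 * F (.T u) z) + (1 / 6 * F (par m (.T u)) z +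
          (1 / 6 * F (.T (false :: u)) z + 1 / 6 * F (.T (true :: u)) z)) := by
        funext z; rw [stepOp_T _ _ hu]; ring
      rw [stepOp_T _ _ hu, h]
      simp only [avT_add, avT_mul, idx_par_T]; simp only [idx]; ring
    · have h : stepOp F (.T u) = fun z => (1 / 2 * F (.T u) z) + (1 / 6 * F (par m (.T u)) z +
          1 / 3 * av 0 (F (.B u)) z) := by
        funext z; rw [stepOp_T_last _ _ hu]; ring
      simp only [Valid] at hn
      rw [stepOp_T_last _ _ hu, h]
      simp only [avT_add, avT_mul, idx_par_T]; simp only [idx]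
      rw [show u.length + 2 - m = 0 + 1 by omega, av_avT_succ, avT_av]
      ring
  · have hn' := hn
    simp only [Valid] at hn'
    obtain ⟨i, hi⟩ : ∃ i, u.length + 1 - m = i := ⟨_, rfl⟩
    have hi' : u.length + 2 - m = i + 1 := by omega
    have hi'' : u.length + 1 + 2 - m = i + 1 + 1 := by omega
    have hp := idx_par_B hn
    rw [hi] at hp
    by_cases hu : u.length + 2 < 3 * m
    · have h : stepOp F (.B u) = fun z => (1 / 2 * F (.B u) z) + (1 / 6 * av i (F (par m (.B u))) z +
          (1 / 6 * av (i + 1) (F (.B (false :: u))) z +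
            1 / 6 * av (i + 1) (F (.B (true :: u))) z)) := by
        funext z; rw [stepOp_B _ _ hu, hi, hi']; ring
      rw [stepOp_B _ _ hu, h, hi, hi', hp]
      simp only [avT_add, avT_mul, idx, List.length_cons, hi', hi'']
      rw [av_avT_succ, av_avT_succ, avT_av, avT_av, av_avT, avT_succ_av]
      ring
    · have h : stepOp F (.B u) = fun z => (1 / 2 * F (.B u) z) +
          (1 / 2 * av i (F (par m (.B u))) z) := by
        funext z; rw [stepOp_B_leaf _ _ hu, hi]; ring
      rw [stepOp_B_leaf _ _ hu, h, hi, hp]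
      simp only [avT_add, avT_mul, idx, hi']
      rw [av_avT, avT_succ_av]
      ring

end Lamp

namespace Lamp

variable {m : ℕ} {hm : 1 ≤ m}

/-! ### Mixing time of the cover -/

lemma hitR_nonneg {d j : ℕ} (h : j ≤ d) : 0 ≤ hitR d j := by
  have : (j : ℝ) ≤ d := by exact_mod_cast h
  have : (0 : ℝ) ≤ 16 * 2 ^ d * (1 / 2) ^ j := by positivity
  rw [hitR]; linarith

lemma hitR_le {d j : ℕ} : hitR d j ≤ 30 * 2 ^ d := by
  have h1 : (d : ℝ) ≤ 2 ^ d := by exact_mod_cast Nat.lt_two_pow_self.le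
  have h2 : ((1 : ℝ) / 2) ^ j ≤ 1 := pow_le_one₀ (by norm_num) (by norm_num)
  have h3 := mul_le_mul_of_nonneg_left h2 (show (0 : ℝ) ≤ 16 * 2 ^ d by positivity)
  have h4 : (0 : ℝ) ≤ j := Nat.cast_nonneg j
  rw [hitR]; linarith [show (0 : ℝ) < 2 ^ d by positivity]

lemma hitL_nonneg {d j : ℕ} (h : j ≤ d) : 0 ≤ hitL d j := by
  have := hit_nonneg h
  rw [hitL]; positivity

lemma hitL_le {d j : ℕ} : hitL d j ≤ 30 * 2 ^ d := by
  have h1 : (d : ℝ) ≤ 2 ^ d := by exact_mod_cast Nat.lt_two_pow_self.le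
  have := hit_le d j
  rw [hitL]; linarith

/-- A right leaf. -/
def IsRightLeaf (m : ℕ) (n : Node) : Prop := ∃ u, n = .B u ∧ ¬ u.length + 2 < 3 * m

lemma stepOp_hitLR (hm : 1 ≤ m) {n : Node} (hn : Valid m n) (h : ¬ IsRightLeaf m n) (z : Sheet m) :
    stepOp (fun n _ => lv (hitL (3 * m)) (hitR (3 * m)) n) n z ≤
      lv (hitL (3 * m)) (hitR (3 * m)) n - 1 := by
  by_cases hno : n = .o
  · subst hno
    rw [stepOp_lv_o]
    have h1 : (0 : ℝ) < 2 ^ (3 * m) := by positivity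
    simp only [lv, hitL, hitR, hit, pow_zero, pow_one]
    push_cast
    linarith
  · refine stepOp_lv hm (R := fun x y => x ≤ y - 1) (by simp [hitL, hitR, hit]) (fun j _ => ?_)
      (fun j hj => ?_) (fun j _ => (hitR_step _ j).le) hn hno (Or.inl fun u hu => ?_) z
    · have := hit_step (3 * m) j
      simp only [hitL]; linarith
    · have := hit_leaf hj
      simp only [hitL]; linarith
    · by_contra hlt
      exact h ⟨u, hu, hlt⟩

lemma ext_pow_succ (F : Vert m → ℝ) (s : ℕ) {n : Node} (hn : Valid m n) (z : Sheet m) :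
    ext ((walkMat (cover m hm) ^ (s + 1)).mulVec F) n z =
      stepOp (ext ((walkMat (cover m hm) ^ s).mulVec F)) n z := by
  rw [pow_succ_mulVec, ext_mulVec _ hn]

lemma stepOp_sub_const (F : Node → Sheet m → ℝ) (c : ℝ) (n : Node) (z : Sheet m) :
    stepOp (fun n z => F n z - c) n z = stepOp F n z - c := by
  have := stepOp_affine F (-c) 1 n z
  simp only [one_mul, neg_add_eq_sub] at this
  exact this

lemma abs_ext_pow_sub_le {F : Vert m → ℝ} (hF : ∀ v, |F v| ≤ 1) {t : ℕ} (ht : 352 * 2 ^ (3 * m) ≤ t)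
    {n : Node} (hn : Valid m n) (z : Sheet m) :
    |avT (idx m n) (ext ((walkMat (cover m hm) ^ t).mulVec F) n) z -
      ∑ v, degSta (cover m hm) v * F v| ≤ 1 / 3 := by
  have hG : ∀ v, 0 < deg (cover m hm) v := deg_cover_pos
  have hπ := isProb_degSta hG
  have hP := isStoch_walkMat hG
  set c := ∑ v, degSta (cover m hm) v * F v with hc
  have hc1 : |c| ≤ 1 := by
    refine (Finset.abs_sum_le_sum_abs _ _).trans ?_
    rw [← hπ.2]
    refine Finset.sum_le_sum fun v _ => ?_
    rw [abs_mul, abs_of_pos (hπ.1 v)]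
    exact mul_le_of_le_one_right (hπ.1 v).le (hF v)
  obtain ⟨s, rfl⟩ := Nat.exists_eq_add_of_le (show 288 * 2 ^ (3 * m) ≤ t by omega)
  have h1 : (1 : ℝ) ≤ 2 ^ (3 * m) := one_le_pow₀ (by norm_num)
  have hs : 8 * (8 * 2 ^ (3 * m) : ℝ) ≤ s := by
    have : 64 * 2 ^ (3 * m) ≤ s := by omega
    have : ((64 * 2 ^ (3 * m) : ℕ) : ℝ) ≤ s := by exact_mod_cast this
    push_cast at this; linarith
  refine (abs_le_of_potential hm (m := m)
    (Ψ := fun s n z => avT (idx m n)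
      (ext ((walkMat (cover m hm) ^ (288 * 2 ^ (3 * m) + s)).mulVec F) n) z - c)
    ?_ ?_ (T := fun n => n = .o) (ε := 1 / 6) (by norm_num) ?_
    (W := lv (hit (3 * m)) (hit (3 * m))) (K := 8 * 2 ^ (3 * m)) (by linarith)
    (fun n hn => lv_prop hm (R := fun x => 0 ≤ x) (fun _ h => hit_nonneg h)
      (fun _ h => hit_nonneg h) hn)
    (fun n hn => lv_prop hm (R := fun x => x ≤ 8 * 2 ^ (3 * m)) (fun _ _ => hit_le _ _)
      (fun _ _ => hit_le _ _) hn)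
    (fun n hn h z => (stepOp_hit hm hn h z).le) hs hn z).trans (by norm_num)
  · intro s n hn z
    rw [stepOp_sub_const (fun n z => avT (idx m n)
      (ext ((walkMat (cover m hm) ^ (288 * 2 ^ (3 * m) + s)).mulVec F) n) z), ← avT_stepOp _ hn,
      ← add_assoc]
    congr 2
    exact funext fun z => ext_pow_succ F _ hn z
  · intro n hn z
    refine (abs_sub _ _).trans ?_
    have := abs_avT_le (M := 1) (g := ext ((walkMat (cover m hm) ^ (288 * 2 ^ (3 * m) + 0)).mulVec F) n)
      (fun z => by rw [ext_apply _ hn]; exact abs_pow_mulVec_le hP hF _ _) (idx m n) z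
    linarith
  · rintro s n hn rfl z
    dsimp only [idx]
    rw [avT_zero]
    have h : ext ((walkMat (cover m hm) ^ (288 * 2 ^ (3 * m) + s)).mulVec F) .o =
        fun z => ((walkMat (cover m hm) ^ (288 * 2 ^ (3 * m) + s)).mulVec F) (root z) :=
      funext fun z => ext_apply _ hn z
    rw [h]
    exact abs_avg_root_le hF (by omega)

/-- The mixing time of the cover is of the order of the size of the base tree. -/
lemma dTV_cover_le : dTV (walkMat (cover m hm)) (degSta (cover m hm)) (592 * 2 ^ (3 * m)) ≤ 1 / 4 := by
  have hG : ∀ v, 0 < deg (cover m hm) v := deg_cover_pos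
  have hπ := isProb_degSta hG
  have hP := isStoch_walkMat hG
  refine dTV_le fun v => tvDist_le_of_forall fun F hF => ?_
  set c := ∑ v, degSta (cover m hm) v * F v with hc
  have hc1 : |c| ≤ 1 := by
    refine (Finset.abs_sum_le_sum_abs _ _).trans ?_
    rw [← hπ.2]
    refine Finset.sum_le_sum fun v _ => ?_
    rw [abs_mul, abs_of_pos (hπ.1 v)]
    exact mul_le_of_le_one_right (hπ.1 v).le (hF v)
  have h1 : (1 : ℝ) ≤ 2 ^ (3 * m) := one_le_pow₀ (by norm_num)
  have key := abs_le_of_potential hm (m := m)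
    (Ψ := fun s n z => ext ((walkMat (cover m hm) ^ (352 * 2 ^ (3 * m) + s)).mulVec F) n z - c)
    ?_ ?_ (T := IsRightLeaf m) (ε := 1 / 3) (by norm_num) ?_
    (W := lv (hitL (3 * m)) (hitR (3 * m))) (K := 30 * 2 ^ (3 * m)) (by linarith)
    (fun n hn => lv_prop hm (R := fun x => 0 ≤ x) (fun _ h => hitL_nonneg h)
      (fun _ h => hitR_nonneg h) hn)
    (fun n hn => lv_prop hm (R := fun x => x ≤ 30 * 2 ^ (3 * m)) (fun _ _ => hitL_le)
      (fun _ _ => hitR_le) hn)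
    (fun n hn h z => stepOp_hitLR hm hn h z) (s := 240 * 2 ^ (3 * m)) (by push_cast; linarith) v.1.2 v.2
  · rw [ext_apply _ v.1.2, ← add_mul] at key
    exact key.trans (by norm_num)
  · intro s n hn z
    rw [stepOp_sub_const, ← ext_pow_succ F _ hn, add_assoc]
  · intro n hn z
    refine (abs_sub _ _).trans ?_
    rw [ext_apply _ hn]
    have := abs_pow_mulVec_le hP hF (352 * 2 ^ (3 * m) + 0) (⟨n, hn⟩, z)
    linarith
  · rintro s n hn ⟨u, rfl, hu⟩ z
    have := abs_ext_pow_sub_le (hm := hm) hF (t := 352 * 2 ^ (3 * m) + s) (by omega) hn z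
    rwa [avT_top (by simp only [idx]; omega)] at this

end Lamp

/-- An idempotent map that identifies at most pairs of points, as a lumping. -/
lemma exists_lump_of_idempotent (f : V → V) (h1 : ∀ a, f (f a) = f a)
    (h2 : ∀ a b, f a ≠ a → f b ≠ b → f a = f b → a = b) :
    ∃ (k : ℕ) (p : V → Fin k), Function.Surjective p ∧ (∀ a b, p a = p b ↔ f a = f b) ∧
      (∀ i, Nat.card {a // p a = i} = 1 ∨ Nat.card {a // p a = i} = 2) ∧
      ∀ β : V → ℝ, (∀ a, f a = a → β a ≤ 0) → (∀ a, f a ≠ a → β a + β (f a) ≤ 0) →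
        ∀ i, (∑ a, if p a = i then β a else 0) ≤ 0 := by
  classical
  let e := Fintype.equivFin (Set.range f)
  let p : V → Fin (Fintype.card (Set.range f)) := fun a => e ⟨f a, a, rfl⟩
  have hp : ∀ a b, p a = p b ↔ f a = f b := fun a b =>
    e.injective.eq_iff.trans Subtype.mk_eq_mk
  have hs : Function.Surjective p := by
    intro i
    obtain ⟨⟨_, a, rfl⟩, rfl⟩ := e.surjective i
    exact ⟨a, rfl⟩
  have hfib : ∀ i, ∃ w, f w = w ∧ ((∀ a, p a = i ↔ a = w) ∨
      ∃ b, b ≠ w ∧ f b = w ∧ ∀ a, p a = i ↔ a = w ∨ a = b) := by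
    intro i
    obtain ⟨c, rfl⟩ := hs i
    refine ⟨f c, h1 c, ?_⟩
    by_cases hb : ∃ b, b ≠ f c ∧ f b = f c
    · obtain ⟨b, hb, hbc⟩ := hb
      refine Or.inr ⟨b, hb, hbc, fun a => ?_⟩
      rw [hp]
      constructor
      · intro ha
        by_cases hac : a = f c
        · exact Or.inl hac
        · exact Or.inr (h2 a b (fun h => hac (h ▸ ha)) (fun h => hb (h ▸ hbc)) (ha.trans hbc.symm))
      · rintro (rfl | rfl)
        exacts [h1 c, hbc]
    · push Not at hb
      refine Or.inl fun a => ?_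
      rw [hp]
      constructor
      · intro ha
        by_contra hac
        exact hb a hac ha
      · rintro rfl; exact h1 c
  refine ⟨_, p, hs, hp, fun i => ?_, fun β hβ1 hβ2 i => ?_⟩
  · obtain ⟨w, hw, h | ⟨b, hb, -, h⟩⟩ := hfib i
    · left
      have : {a | p a = i} = {w} := by ext a; simp [h]
      change Nat.card ({a | p a = i} : Set V) = 1
      rw [this]; simp
    · right
      have : {a | p a = i} = {w, b} := by ext a; simp [h]
      change Nat.card ({a | p a = i} : Set V) = 2
      rw [this, Nat.card_coe_set_eq, Set.ncard_pair hb.symm]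
  · rw [← Finset.sum_filter]
    obtain ⟨w, hw, h | ⟨b, hb, hbw, h⟩⟩ := hfib i
    · have : (univ.filter fun a => p a = i) = {w} := by ext a; simp [h]
      rw [this, Finset.sum_singleton]
      exact hβ1 w hw
    · have : (univ.filter fun a => p a = i) = {b, w} := by ext a; simp [h, or_comm]
      rw [this, Finset.sum_pair hb]
      have := hβ2 b (by rw [hbw]; exact hb.symm)
      rwa [hbw] at this

namespace Lamp

variable {m : ℕ} {hm : 1 ≤ m}

/-! ### The labels of the sheets -/

/-- The length of a chain of excursions. -/
def gen : List (List Bool) → ℕ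
  | [] => 0
  | u :: l => gen l + (u.length + 1)

/-- Append an excursion to a code. -/
def encL : List Bool → ℕ → ℕ
  | [], e => 3 * e + 3
  | x :: u, e => 3 * encL u e + if x then 2 else 1

/-- The code of a chain of excursions. -/
def enc : List (List Bool) → ℕ
  | [] => 0
  | u :: l => encL u (enc l)

lemma encL_pos (u : List Bool) (e : ℕ) : 0 < encL u e := by
  cases u <;> simp only [encL]
  · omega
  · split_ifs <;> omega

lemma encL_le (u : List Bool) (e : ℕ) : 2 * encL u e + 3 ≤ 3 ^ (u.length + 1) * (2 * e + 3) := by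
  induction u with
  | nil => simp only [encL, List.length_nil]; omega
  | cons x u ih =>
    rw [List.length_cons, pow_succ, mul_comm _ 3, mul_assoc]
    simp only [encL]
    split_ifs <;> omega

lemma enc_le (l : List (List Bool)) : 2 * enc l + 3 ≤ 3 ^ (gen l + 1) := by
  induction l with
  | nil => simp [enc, gen]
  | cons u l ih =>
    refine (encL_le u _).trans ((Nat.mul_le_mul_left _ ih).trans ?_)
    rw [← pow_add, gen]
    exact Nat.pow_le_pow_right (by norm_num) (by omega)

lemma encL_inj {u u' : List Bool} {e e' : ℕ} (h : encL u e = encL u' e') : u = u' ∧ e = e' := by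
  induction u generalizing u' with
  | nil =>
    rcases u' with _ | ⟨x, u'⟩ <;> simp only [encL] at h
    · exact ⟨rfl, by omega⟩
    · split_ifs at h <;> omega
  | cons x u ih =>
    rcases u' with _ | ⟨x', u'⟩ <;> simp only [encL] at h
    · split_ifs at h <;> omega
    · have hx : x = x' := by cases x <;> cases x' <;> simp at h ⊢ <;> omega
      subst hx
      obtain ⟨rfl, rfl⟩ := ih (u' := u') (by omega)
      exact ⟨rfl, rfl⟩

lemma enc_injective : Function.Injective enc := by
  intro l
  induction l with
  | nil =>
    rintro (_ | ⟨u, l'⟩) h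
    · rfl
    · exact absurd h (encL_pos _ _).ne
  | cons u l ih =>
    rintro (_ | ⟨u', l'⟩) h
    · exact absurd h (encL_pos _ _).ne'
    · obtain ⟨rfl, h'⟩ := encL_inj h
      rw [ih h']

/-- The sheet with a given label. -/
def sheet (m : ℕ) (l : List (List Bool)) : Sheet m := fun j => (enc l).testBit j

lemma enc_lt_three_pow {l : List (List Bool)} (hl : gen l < m) : enc l < 3 ^ m := by
  have h1 := enc_le l
  have h2 : 3 ^ (gen l + 1) ≤ 3 ^ m := Nat.pow_le_pow_right (by norm_num) hl
  omega

lemma sheet_inj {l l' : List (List Bool)} (hl : gen l < m) (hl' : gen l' < m)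
    (h : sheet m l = sheet m l') : l = l' := by
  refine enc_injective (Nat.eq_of_testBit_eq fun i => ?_)
  by_cases hi : i < 2 * m
  · exact congrFun h ⟨i, hi⟩
  · have h4 : 3 ^ m ≤ 2 ^ i := by
      calc 3 ^ m ≤ 4 ^ m := Nat.pow_le_pow_left (by norm_num) m
        _ = 2 ^ (2 * m) := by rw [pow_mul]; norm_num
        _ ≤ 2 ^ i := Nat.pow_le_pow_right (by norm_num) (by omega)
    rw [Nat.testBit_lt_two_pow ((enc_lt_three_pow hl).trans_le h4),
      Nat.testBit_lt_two_pow ((enc_lt_three_pow hl').trans_le h4)]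

open Classical in
/-- The label of a sheet, of large length for the sheets that have no label. -/
def lab (z : Sheet m) : List (List Bool) :=
  if h : ∃ l, gen l < m ∧ sheet m l = z then h.choose else [List.replicate m false]

lemma lab_sheet {l : List (List Bool)} (hl : gen l < m) : lab (sheet m l) = l := by
  have h : ∃ l', gen l' < m ∧ sheet m l' = sheet m l := ⟨l, hl, rfl⟩
  rw [lab, dif_pos h]
  exact sheet_inj h.choose_spec.1 hl h.choose_spec.2

lemma sheet_lab {z : Sheet m} (hz : gen (lab z) < m) : sheet m (lab z) = z := by
  by_cases h : ∃ l, gen l < m ∧ sheet m l = z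
  · rw [lab, dif_pos h]
    exact h.choose_spec.2
  · rw [lab, dif_neg h] at hz
    simp [gen] at hz

lemma four_mul_card_lab_le (h5 : 5 ≤ m) :
    4 * (univ.filter fun z : Sheet m => gen (lab z) < m).card ≤ 2 ^ (2 * m) := by
  classical
  have h1 : (univ.filter fun z : Sheet m => gen (lab z) < m) ⊆
      (Finset.range (3 ^ m)).image fun e => fun j : Fin (2 * m) => e.testBit j := by
    intro z hz
    have hz := (Finset.mem_filter.1 hz).2
    exact Finset.mem_image.2 ⟨enc (lab z), Finset.mem_range.2 (enc_lt_three_pow hz), sheet_lab hz⟩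
  have h2 : (univ.filter fun z : Sheet m => gen (lab z) < m).card ≤ 3 ^ m :=
    (Finset.card_le_card h1).trans (Finset.card_image_le.trans (Finset.card_range _).le)
  obtain ⟨i, rfl⟩ := Nat.exists_eq_add_of_le h5
  calc _ ≤ 4 * 3 ^ (5 + i) := Nat.mul_le_mul_left _ h2
    _ = 972 * 3 ^ i := by ring
    _ ≤ 1024 * 4 ^ i := Nat.mul_le_mul (by norm_num) (Nat.pow_le_pow_left (by norm_num) i)
    _ = _ := by rw [pow_mul, pow_add]; norm_num

open Classical in
/-- The root of the sheet in which an excursion continues, for vertices of the top part. -/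
def glue (v : Vert m) : Vert m :=
  match v with
  | (⟨.T u, _⟩, z) => if gen (u :: lab z) < m then root (sheet m (u :: lab z)) else v
  | _ => v

lemma glue_root (z : Sheet m) : glue (root z) = root z := rfl

lemma glue_ne {v : Vert m} (h : glue v ≠ v) : ∃ u, v.1.1 = .T u ∧ gen (u :: lab v.2) < m ∧
    glue v = root (sheet m (u :: lab v.2)) := by
  obtain ⟨⟨_ | u | u | u, hn⟩, z⟩ := v
  · exact absurd rfl h
  · exact absurd rfl h
  · by_cases hu : gen (u :: lab z) < m
    · exact ⟨u, rfl, hu, if_pos hu⟩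
    · exact absurd (if_neg hu) h
  · exact absurd rfl h

lemma glue_glue (v : Vert m) : glue (glue v) = glue v := by
  by_cases h : glue v = v
  · rw [h, h]
  · obtain ⟨u, -, -, h⟩ := glue_ne h
    rw [h, glue_root]

lemma glue_inj {v w : Vert m} (hv : glue v ≠ v) (hw : glue w ≠ w) (h : glue v = glue w) : v = w := by
  obtain ⟨u, h1, h2, h3⟩ := glue_ne hv
  obtain ⟨u', h1', h2', h3'⟩ := glue_ne hw
  rw [h3, h3'] at h
  have h4 := sheet_inj h2 h2' (congrArg Prod.snd h)
  simp only [List.cons.injEq] at h4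
  obtain ⟨rfl, h4⟩ := h4
  simp only [gen] at h2 h2'
  have h5 : v.2 = w.2 := by
    rw [← sheet_lab (z := v.2) (by omega), h4, sheet_lab (by omega)]
  exact Prod.ext (Subtype.ext (h1.trans h1'.symm)) h5

/-! ### A slowly growing function -/

/-- The value at the root of a sheet whose label has length `g`. -/
def val (m g : ℕ) : ℝ := (12 / 13) ^ (m - g)

lemma val_pos (m g : ℕ) : 0 < val m g := by unfold val; positivity

lemma val_le_one (m g : ℕ) : val m g ≤ 1 := pow_le_one₀ (by norm_num) (by norm_num)

lemma val_of_le {g : ℕ} (h : m ≤ g) : val m g = 1 := by simp [val, Nat.sub_eq_zero_of_le h]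

lemma val_succ {g : ℕ} (h : g < m) : val m g = 12 / 13 * val m (g + 1) := by
  rw [val, val, show m - g = m - (g + 1) + 1 by omega, pow_succ]; ring

/-- The decay in the left subtree. -/
def decay (j : ℕ) : ℝ := (1 + (1 / 2) ^ j) / 2

lemma half_le_decay (j : ℕ) : 1 / 2 ≤ decay j := by
  have : (0 : ℝ) ≤ (1 / 2) ^ j := by positivity
  rw [decay]; linarith

lemma decay_le_one (j : ℕ) : decay j ≤ 1 := by
  have : ((1 : ℝ) / 2) ^ j ≤ 1 := pow_le_one₀ (by norm_num) (by norm_num)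
  rw [decay]; linarith

/-- The test function for the lower bound of the mixing time of the lumped chain. -/
def psi (m : ℕ) : Node → Sheet m → ℝ
  | .o, z => val m (gen (lab z))
  | .L u, z => val m (gen (lab z)) * decay (u.length + 1)
  | .T u, z => val m (gen (lab z) + (u.length + 1))
  | .B _, _ => 1

lemma psi_nonneg (n : Node) (z : Sheet m) : 0 ≤ psi m n z := by
  rcases n with _ | u | u | u <;> simp only [psi]
  · exact (val_pos _ _).le
  · exact mul_nonneg (val_pos _ _).le (by linarith [half_le_decay (u.length + 1)])
  · exact (val_pos _ _).le
  · norm_num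

lemma psi_le_one (n : Node) (z : Sheet m) : psi m n z ≤ 1 := by
  rcases n with _ | u | u | u <;> simp only [psi]
  · exact val_le_one _ _
  · exact mul_le_one₀ (val_le_one _ _) (by linarith [half_le_decay (u.length + 1)]) (decay_le_one _)
  · exact val_le_one _ _
  · norm_num

lemma half_le_psi {z : Sheet m} (hz : m ≤ gen (lab z)) (n : Node) : 1 / 2 ≤ psi m n z := by
  rcases n with _ | u | u | u <;> simp only [psi]
  · rw [val_of_le hz]; norm_num
  · rw [val_of_le hz, one_mul]; exact half_le_decay _
  · rw [val_of_le (by omega)]; norm_num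
  · norm_num

lemma psi_par_L (u : List Bool) (z : Sheet m) :
    psi m (par m (.L u)) z = val m (gen (lab z)) * decay u.length := by
  cases u <;> simp [par, psi, decay]

lemma psi_par_T (u : List Bool) (z : Sheet m) :
    psi m (par m (.T u)) z = val m (gen (lab z) + u.length) := by
  cases u <;> simp [par, psi]

lemma psi_glue (v : Vert m) : psi m (glue v).1.1 (glue v).2 = psi m v.1.1 v.2 := by
  by_cases h : glue v = v
  · rw [h]
  · obtain ⟨u, h1, h2, h3⟩ := glue_ne h
    rw [h3, h1]
    simp only [root, psi]
    rw [lab_sheet h2, gen]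

lemma stepOp_psi_le_one (n : Node) (z : Sheet m) : stepOp (psi m) n z ≤ 1 := by
  have : ∀ l : List (Node × Sheet m), (l.map fun x => psi m x.1 x.2).sum ≤ l.length := by
    intro l
    induction l with
    | nil => simp
    | cons x l ih =>
      simp only [List.map_cons, List.sum_cons, List.length_cons]
      push_cast
      linarith [psi_le_one x.1 x.2]
  have h1 := this (nb m n z)
  rw [length_nb] at h1
  have h2 : (0 : ℝ) < dg m n := by exact_mod_cast dg_pos n
  have h3 : 1 / (2 * (dg m n : ℝ)) * nbSum (psi m) n z ≤ 1 / 2 := by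
    rw [div_mul_eq_mul_div, one_mul, div_le_div_iff₀ (by positivity) two_pos]
    rw [nbSum]; linarith
  have := psi_le_one n z
  rw [stepOp]; linarith

/-- The growth rate of the test function. -/
def rate (m : ℕ) : ℝ := (1 / 2) ^ (3 * m) / 2

lemma rate_pos (m : ℕ) : 0 < rate m := by unfold rate; positivity

lemma stepOp_psi_o {z : Sheet m} (hz : gen (lab z) < m) :
    stepOp (psi m) .o z - psi m .o z = - (val m (gen (lab z)) / 24) := by
  rw [stepOp_o]
  simp only [psi, List.length_nil, zero_add, decay]
  rw [val_succ hz]; ring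

lemma stepOp_psi_T {u : List Bool} {z : Sheet m} (hz : gen (lab z) + (u.length + 1) < m) :
    stepOp (psi m) (.T u) z - psi m (.T u) z =
      7 / 468 * val m (gen (lab z) + (u.length + 1)) := by
  rw [stepOp_T _ _ (by omega), psi_par_T]
  simp only [psi, List.length_cons]
  rw [← add_assoc] at hz
  simp only [← add_assoc]
  rw [val_succ (g := gen (lab z) + u.length) (by omega), val_succ hz]
  ring

lemma stepOp_psi_L {u : List Bool} {z : Sheet m} (hu : u.length < 3 * m) :
    stepOp (psi m) (.L u) z ≤ (1 + rate m) * psi m (.L u) z := by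
  have h0 := mul_nonneg (rate_pos m).le (psi_nonneg (.L u) z)
  by_cases h : u.length + 1 < 3 * m
  · have : stepOp (psi m) (.L u) z = psi m (.L u) z := by
      rw [stepOp_L _ _ h, psi_par_L]
      simp only [psi, List.length_cons, decay, pow_succ]
      ring
    rw [this]; linarith
  · rw [stepOp_L_leaf _ _ h, psi_par_L]
    have h1 : 3 * m = u.length + 1 := by omega
    simp only [psi] at h0 ⊢
    have h2 := mul_le_mul_of_nonneg_left (half_le_decay (u.length + 1))
      (mul_nonneg (rate_pos m).le (val_pos m (gen (lab z))).le)
    rw [rate, h1] at h2 ⊢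
    have h3 : decay u.length = decay (u.length + 1) + (1 / 2) ^ (u.length + 1) / 2 := by
      rw [decay, decay, pow_succ]; ring
    rw [h3]
    linarith

/-- The weighted defect of the test function. -/
def defect (m : ℕ) (v : Vert m) : ℝ :=
  dg m v.1.1 * (stepOp (psi m) v.1.1 v.2 - (1 + rate m) * psi m v.1.1 v.2)

lemma defect_nonpos {v : Vert m} (h : stepOp (psi m) v.1.1 v.2 ≤ (1 + rate m) * psi m v.1.1 v.2) :
    defect m v ≤ 0 :=
  mul_nonpos_of_nonneg_of_nonpos (Nat.cast_nonneg _) (by linarith)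

lemma defect_le_of_glue_eq (v : Vert m) (h : glue v = v) : defect m v ≤ 0 := by
  refine defect_nonpos ?_
  have h0 := mul_nonneg (rate_pos m).le (psi_nonneg v.1.1 v.2)
  have hone : psi m v.1.1 v.2 = 1 →
      stepOp (psi m) v.1.1 v.2 ≤ (1 + rate m) * psi m v.1.1 v.2 := by
    intro h1
    have := stepOp_psi_le_one v.1.1 v.2
    rw [h1]
    linarith [rate_pos m]
  obtain ⟨⟨_ | u | u | u, hn⟩, z⟩ := v
  · by_cases hz : gen (lab z) < m
    · have h1 := stepOp_psi_o hz
      have h2 := val_pos m (gen (lab z))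
      dsimp only at h0 ⊢
      linarith
    · exact hone (val_of_le (not_lt.1 hz))
  · exact stepOp_psi_L hn
  · by_cases hz : gen (u :: lab z) < m
    · have h1 : glue (⟨.T u, hn⟩, z) = root (sheet m (u :: lab z)) := if_pos hz
      rw [h] at h1
      have := congrArg (fun v => v.1.1) h1
      simp [root] at this
    · exact hone (val_of_le (not_lt.1 hz))
  · exact hone rfl

lemma defect_add_le (v : Vert m) (h : glue v ≠ v) : defect m v + defect m (glue v) ≤ 0 := by
  obtain ⟨u, h1, h2, h3⟩ := glue_ne h
  have h4 : gen (lab v.2) + (u.length + 1) < m := h2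
  have h5 := stepOp_psi_T h4
  have h6 : gen (lab (sheet m (u :: lab v.2))) < m := by rwa [lab_sheet h2]
  have h7 := stepOp_psi_o h6
  rw [lab_sheet h2] at h7
  have h8 : gen (u :: lab v.2) = gen (lab v.2) + (u.length + 1) := rfl
  rw [h8] at h7
  have h9 := val_pos m (gen (lab v.2) + (u.length + 1))
  have h10 := mul_nonneg (rate_pos m).le (psi_nonneg (.T u) v.2)
  have h11 := mul_nonneg (rate_pos m).le (psi_nonneg .o (sheet m (u :: lab v.2)))
  rw [defect, defect, h3, h1]
  simp only [root, dg]
  push_cast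
  linarith

lemma sum_degSta_psi (h5 : 5 ≤ m) :
    3 / 8 ≤ ∑ v, degSta (cover m hm) v * psi m v.1.1 v.2 := by
  classical
  have hG : ∀ v, 0 < deg (cover m hm) v := deg_cover_pos
  have hπ := isProb_degSta hG
  set r : {n // Valid m n} → ℝ := fun n => degSta (cover m hm) (n, fun _ => false) with hr
  have hr' : ∀ n z, degSta (cover m hm) (n, z) = r n := by
    intro n z
    simp only [hr, degSta, deg_cover, length_nb]
  have hr0 : ∀ n, 0 ≤ r n := fun n => (hπ.1 _).le
  have h1 : (∑ n, r n) * 2 ^ (2 * m) = 1 := by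
    rw [← hπ.2, Fintype.sum_prod_type, Finset.sum_mul]
    refine Finset.sum_congr rfl fun n _ => ?_
    simp [hr', mul_comm]
  have h2 : ∀ n, r n * (3 / 8 * 2 ^ (2 * m)) ≤ ∑ z, degSta (cover m hm) (n, z) * psi m n.1 z := by
    intro n
    simp only [hr', ← Finset.mul_sum]
    refine mul_le_mul_of_nonneg_left ?_ (hr0 n)
    have h3 : ∀ z : Sheet m, 1 / 2 - 1 / 2 * (if gen (lab z) < m then 1 else 0) ≤ psi m n.1 z := by
      intro z
      split_ifs with hz
      · linarith [psi_nonneg n.1 z]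
      · linarith [half_le_psi (not_lt.1 hz) n.1]
    refine le_trans ?_ (Finset.sum_le_sum fun z _ => h3 z)
    rw [Finset.sum_sub_distrib, ← Finset.mul_sum, Finset.sum_boole]
    have h4 : (4 : ℝ) * ((univ.filter fun z : Sheet m => gen (lab z) < m).card : ℝ) ≤ 2 ^ (2 * m) := by
      exact_mod_cast four_mul_card_lab_le h5
    simp
    linarith
  rw [Fintype.sum_prod_type]
  refine le_trans ?_ (Finset.sum_le_sum fun n _ => h2 n)
  rw [← Finset.sum_mul]
  linarith

lemma rate_pow_lt (h100 : 100 ≤ m) {t : ℕ} (ht : 13 * t ≤ m * 2 ^ (3 * m)) :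
    (1 + rate m) ^ t * (12 / 13) ^ m < 1 / 8 := by
  have h1 : (1 + rate m) ^ t ≤ Real.exp (m / 26) := by
    calc (1 + rate m) ^ t ≤ Real.exp (rate m) ^ t := by
          have := Real.add_one_le_exp (rate m)
          have := rate_pos m
          gcongr
          linarith
      _ = Real.exp (t * rate m) := by rw [← Real.exp_nat_mul]
      _ ≤ _ := by
          gcongr
          have h2 : (13 * t : ℝ) ≤ m * 2 ^ (3 * m) := by exact_mod_cast ht
          have h3 : (2 : ℝ) ^ (3 * m) * (1 / 2) ^ (3 * m) = 1 := by rw [← mul_pow]; norm_num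
          have h4 := mul_le_mul_of_nonneg_right h2 (rate_pos m).le
          rw [rate] at h4 ⊢
          linear_combination h4 / 13 + m / 26 * h3
  have h2 : ((12 : ℝ) / 13) ^ m ≤ Real.exp (-(m / 13)) := by
    calc ((12 : ℝ) / 13) ^ m ≤ Real.exp (-(1 / 13)) ^ m := by
          have := Real.add_one_le_exp (-(1 / 13) : ℝ)
          gcongr
          linarith
      _ = Real.exp (-(m / 13)) := by rw [← Real.exp_nat_mul]; congr 1; ring
  have h3 : (100 : ℝ) ≤ m := by exact_mod_cast h100
  calc (1 + rate m) ^ t * (12 / 13) ^ m ≤ Real.exp (m / 26) * Real.exp (-(m / 13)) :=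
        mul_le_mul h1 h2 (by positivity) (Real.exp_pos _).le
    _ = Real.exp (-(m / 26)) := by rw [← Real.exp_add]; congr 1; ring
    _ ≤ Real.exp (-3) := by gcongr; linarith
    _ < 1 / 8 := by
      rw [Real.exp_neg, ← one_div]
      refine one_div_lt_one_div_of_lt (by norm_num) ?_
      have : Real.exp 3 = Real.exp 1 ^ 3 := by rw [← Real.exp_nat_mul]; norm_num
      rw [this]
      calc (8 : ℝ) = 2 ^ 3 := by norm_num
        _ < _ := by gcongr; linarith [Real.exp_one_gt_d9]

/-- There is a lumping of the cover that mixes slowly. -/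
lemma exists_slow_lump (h100 : 100 ≤ m) : ∃ (k : ℕ) (p : Vert m → Fin k), Function.Surjective p ∧
    (∀ i, Nat.card {a // p a = i} = 1 ∨ Nat.card {a // p a = i} = 2) ∧
    ∀ t : ℕ, 13 * t ≤ m * 2 ^ (3 * m) →
      1 / 4 < dTV (lumpMat (walkMat (cover m hm)) (degSta (cover m hm)) p)
        (lumpSta (degSta (cover m hm)) p) t := by
  have hG : ∀ v, 0 < deg (cover m hm) v := deg_cover_pos
  have hπ := isProb_degSta hG
  obtain ⟨k, p, hs, hp, hc, hβ⟩ := exists_lump_of_idempotent (glue (m := m)) glue_glue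
    fun _ _ => glue_inj
  refine ⟨k, p, hs, hc, fun t ht => ?_⟩
  set ψ : Fin k → ℝ := fun i =>
    psi m (Function.surjInv hs i).1.1 (Function.surjInv hs i).2 with hψ
  have hψp : ∀ v, ψ (p v) = psi m v.1.1 v.2 := by
    intro v
    have : glue (Function.surjInv hs (p v)) = glue v := (hp _ _).1 (Function.surjInv_eq hs (p v))
    rw [hψ]
    dsimp only
    rw [← psi_glue, this, psi_glue]
  refine lt_dTV_lump (isStoch_walkMat hG) hπ hs (ψ := ψ) (fun i => psi_nonneg _ _)
    (fun i => psi_le_one _ _) (rate_pos m).le (fun i => ?_)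
    (x := root (sheet m [])) ?_ ?_
  · have h1 := hβ (fun v => (∑ u, (deg (cover m hm) u : ℝ))⁻¹ * defect m v)
      (fun v hv => mul_nonpos_of_nonneg_of_nonpos (by positivity) (defect_le_of_glue_eq v hv))
      (fun v hv => by
        rw [← mul_add]
        exact mul_nonpos_of_nonneg_of_nonpos (by positivity) (defect_add_le v hv)) i
    have h2 : ∀ v, (if p v = i then (∑ u, (deg (cover m hm) u : ℝ))⁻¹ * defect m v else 0) =
        (if p v = i then degSta (cover m hm) v *
          ((walkMat (cover m hm)).mulVec (fun b => ψ (p b))) v else 0) -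
        (1 + rate m) * (if p v = i then degSta (cover m hm) v * ψ (p v) else 0) := by
      intro v
      split_ifs
      · simp only [hψp]
        rw [walkMat_cover_mulVec (psi m), degSta, deg_cover v, length_nb, defect]
        ring
      · ring
    rw [Finset.sum_congr rfl fun v _ => h2 v, Finset.sum_sub_distrib, ← Finset.mul_sum] at h1
    linarith
  · rw [hψp]
    simp only [root, psi]
    rw [lab_sheet (show gen [] < m by simp only [gen]; omega)]
    exact rate_pow_lt h100 ht
  · simp only [hψp]
    exact sum_degSta_psi (by omega)

end Lamp

namespace Lamp

variable {m : ℕ} {hm : 1 ≤ m}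

/-! ### Comparison of the mixing times -/

lemma tmixG_cover_pos : 0 < tmixG (cover m hm) (1 / 4) := by
  by_contra! h0
  have hG : ∀ v, 0 < deg (cover m hm) v := deg_cover_pos
  have hπ := isProb_degSta hG
  have ht := dTV_mixTime_le (dTV_cover_le (m := m) (hm := hm))
  change dTV _ _ (tmixG (cover m hm) (1 / 4)) ≤ _ at ht
  rw [Nat.le_zero.1 h0] at ht
  have hκ : (1 : ℝ) ≤ hit (3 * m) 1 / 2 := by
    have : (2 : ℝ) ^ 3 ≤ 2 ^ (3 * m) := pow_le_pow_right₀ (by norm_num) (by omega)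
    rw [hit]; norm_num at this ⊢; linarith
  have hsum : ∑ v, degSta (cover m hm) v * charge v = 0 := by
    have := wInner_charge (m := m) (hm := hm) fun _ => 1
    simpa [wInner, avg, hπ.2] using this
  have hM : ∀ v : Vert m, |charge v| ≤ hit (3 * m) 1 / 2 := by
    intro v
    rw [charge]
    split_ifs
    · rw [abs_of_nonneg (by linarith)]
    · simpa using hκ
  have := (le_abs_self _).trans (abs_pow_mulVec_le_half ht hM hsum (root fun _ => false))
  have hc : charge (root (m := m) fun _ => false) = hit (3 * m) 1 / 2 := if_pos rfl
  rw [pow_zero, Matrix.one_mulVec, hc] at this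
  linarith

lemma log_card_vert_le (hm : 1 ≤ m) : Real.log (Fintype.card (Vert m)) ≤ 9 * m := by
  have h1 : Fintype.card (Vert m) ≤ 2 ^ (9 * m) := by
    calc _ ≤ 4 * 3 ^ (3 * m) * 2 ^ (2 * m) := card_vert_le m
      _ ≤ 4 ^ m * 3 ^ (3 * m) * 2 ^ (2 * m) := by
        gcongr
        exact Nat.le_self_pow (by omega) 4
      _ = (4 * 3 ^ 3 * 2 ^ 2) ^ m := by rw [pow_mul, pow_mul, mul_pow, mul_pow]
      _ ≤ (2 ^ 9) ^ m := Nat.pow_le_pow_left (by norm_num) m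
      _ = _ := by rw [pow_mul]
  have h0 : (0 : ℝ) < Fintype.card (Vert m) := by exact_mod_cast Fintype.card_pos
  calc _ ≤ Real.log (2 ^ (9 * m)) := Real.log_le_log h0 (by exact_mod_cast h1)
    _ = 9 * m * Real.log 2 := by rw [Real.log_pow]; push_cast; ring
    _ ≤ 9 * m * 1 := by
      gcongr
      linarith [Real.log_two_lt_d9]
    _ = _ := mul_one _

lemma mixTime_lump_le (h100 : 100 ≤ m) {k : ℕ} {p : Vert m → Fin k} (hp : Function.Surjective p) :
    dTV (lumpMat (walkMat (cover m hm)) (degSta (cover m hm)) p)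
      (lumpSta (degSta (cover m hm)) p)
      (mixTime (lumpMat (walkMat (cover m hm)) (degSta (cover m hm)) p)
        (lumpSta (degSta (cover m hm)) p) (1 / 4)) ≤ 1 / 4 ∧
    (mixTime (lumpMat (walkMat (cover m hm)) (degSta (cover m hm)) p)
      (lumpSta (degSta (cover m hm)) p) (1 / 4) : ℝ) ≤
      3 * Real.log (Fintype.card (Vert m)) * tmixG (cover m hm) (1 / 4) := by
  have hG : ∀ v, 0 < deg (cover m hm) v := deg_cover_pos
  have hD : ∀ v, deg (cover m hm) v ≤ 6 := fun v => by rw [deg_cover, length_nb]; exact dg_le _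
  set N := Fintype.card (Vert m) with hN
  set s := tmixG (cover m hm) (1 / 4) with hs
  have hs0 : 0 < s := tmixG_cover_pos
  have hsd : dTV (walkMat (cover m hm)) (degSta (cover m hm)) s ≤ 1 / 4 :=
    dTV_mixTime_le dTV_cover_le
  have hN24 : (24 : ℝ) ≤ N := by
    have h1 : 2 ^ 5 ≤ 2 ^ (2 * m) := Nat.pow_le_pow_right (by norm_num) (by omega)
    have h2 := h1.trans (le_card_vert m)
    have : 24 ≤ N := by rw [hN]; omega
    exact_mod_cast this
  have hlog : Real.log (4 / (1 / (((6 : ℕ) : ℝ) * N))) ≤ 2 * Real.log N := by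
    have : (4 : ℝ) / (1 / (((6 : ℕ) : ℝ) * N)) = 24 * N := by
      push_cast; field_simp; norm_num
    rw [this, Real.log_mul (by norm_num) (by linarith), two_mul]
    gcongr
  have hlog1 : 1 ≤ Real.log N := by
    rw [Real.le_log_iff_exp_le (by linarith)]
    linarith [Real.exp_one_lt_d9]
  have hle := dTV_lump_le (isStoch_walkMat hG) (isProb_degSta hG) (rev_walkMat hG) half_le_walkMat
    hp hs0 hsd (c := 1 / (((6 : ℕ) : ℝ) * N)) (by positivity) (le_degSta hG hD)
    (Nat.le_ceil _)
  refine ⟨dTV_mixTime_le hle, ?_⟩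
  refine (Nat.cast_le.2 (mixTime_le hle)).trans ?_
  have hs1 : (1 : ℝ) ≤ s := by exact_mod_cast hs0
  have hpos : 0 ≤ s * Real.log (4 / (1 / (((6 : ℕ) : ℝ) * N))) := by
    refine mul_nonneg (by linarith) (Real.log_nonneg ?_)
    push_cast
    rw [div_div_eq_mul_div, div_one]
    linarith
  have h1 := (Nat.ceil_lt_add_one hpos).le
  have h2 := mul_le_mul_of_nonneg_left hlog (show (0 : ℝ) ≤ s by linarith)
  have h3 := mul_le_mul hs1 hlog1 (by norm_num) (by linarith)
  linarith

lemma exists_lump_mixTime (h100 : 100 ≤ m) (hm : 1 ≤ m) :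
    ∃ (k : ℕ) (p : Vert m → Fin k), Function.Surjective p ∧
    (∀ i, Nat.card {a // p a = i} = 1 ∨ Nat.card {a // p a = i} = 2) ∧
    1 / 69264 * Real.log (Fintype.card (Vert m)) * (tmixG (cover m hm) (1 / 4) : ℝ) ≤
      (mixTime (lumpMat (walkMat (cover m hm)) (degSta (cover m hm)) p)
        (lumpSta (degSta (cover m hm)) p) (1 / 4) : ℝ) ∧
    (mixTime (lumpMat (walkMat (cover m hm)) (degSta (cover m hm)) p)
      (lumpSta (degSta (cover m hm)) p) (1 / 4) : ℝ) ≤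
      3 * Real.log (Fintype.card (Vert m)) * (tmixG (cover m hm) (1 / 4) : ℝ) := by
  obtain ⟨k, p, hs, hc, hp⟩ := exists_slow_lump (hm := hm) h100
  obtain ⟨h1, h2⟩ := mixTime_lump_le (hm := hm) h100 hs
  refine ⟨k, p, hs, hc, ?_, h2⟩
  set t := mixTime (lumpMat (walkMat (cover m hm)) (degSta (cover m hm)) p)
    (lumpSta (degSta (cover m hm)) p) (1 / 4)
  have h3 : m * 2 ^ (3 * m) < 13 * t := by
    by_contra! hle
    exact (hp t hle).not_ge h1
  have h4 : (m * 2 ^ (3 * m) : ℝ) ≤ 13 * t := by exact_mod_cast h3.le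
  have h5 : (tmixG (cover m hm) (1 / 4) : ℝ) ≤ 592 * 2 ^ (3 * m) := by
    exact_mod_cast mixTime_le dTV_cover_le
  have h6 := mul_le_mul (log_card_vert_le hm) h5 (Nat.cast_nonneg _) (by positivity)
  linarith

/-- A copy of the cover on an initial segment of the natural numbers. -/
lemma exists_graph (h100 : 100 ≤ m) : ∃ G : SimpleGraph (Fin (Fintype.card (Vert m))),
    G.Connected ∧ (∀ v, deg G v ≤ 6) ∧
    ∃ (k : ℕ) (p : Fin (Fintype.card (Vert m)) → Fin k), Function.Surjective p ∧
    (∀ i, Nat.card {a // p a = i} = 1 ∨ Nat.card {a // p a = i} = 2) ∧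
    1 / 69264 * Real.log (Fintype.card (Vert m)) * (tmixG G (1 / 4) : ℝ) ≤
      (mixTime (lumpMat (walkMat G) (degSta G) p) (lumpSta (degSta G) p) (1 / 4) : ℝ) ∧
    (mixTime (lumpMat (walkMat G) (degSta G) p) (lumpSta (degSta G) p) (1 / 4) : ℝ) ≤
      3 * Real.log (Fintype.card (Vert m)) * (tmixG G (1 / 4) : ℝ) := by
  have hm : 1 ≤ m := by omega
  obtain ⟨k, p, hs, hc, h⟩ := exists_lump_mixTime h100 hm
  let e := (Fintype.equivFin (Vert m)).symm
  have : Nonempty (Fin (Fintype.card (Vert m))) := e.nonempty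
  have hdeg : degSta ((cover m hm).comap e) = fun w => degSta (cover m hm) (e w) :=
    funext (degSta_comap e _)
  refine ⟨(cover m hm).comap e, ?_, fun v => ?_, k, fun w => p (e w), hs.comp e.surjective,
    fun i => ?_, ?_⟩
  · refine connected_of_dTV_lt (t := 592 * 2 ^ (3 * m)) (fun v => ?_) ?_
    · rw [deg_comap]; exact deg_cover_pos _
    · rw [walkMat_comap, hdeg, dTV_submatrix]; exact dTV_cover_le
  · rw [deg_comap, deg_cover, length_nb]; exact dg_le _
  · have : Nat.card {a // p (e a) = i} = Nat.card {a // p a = i} :=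
      Nat.card_congr (e.subtypeEquiv fun _ => Iff.rfl)
    rw [this]; exact hc i
  · rw [walkMat_comap, hdeg, tmixG_comap, lumpMat_submatrix, lumpSta_comp]
    exact h

end Lamp

/-- **Theorem 3(c).** A sequence of bounded degree graphs such that lumping together some
pairs of vertices increases the order of the total variation mixing time by a factor of
`Θ(log |V_n|)`. -/
theorem lumping_increases_mixing_by_log_factor :
    ∃ (D : ℕ) (N : ℕ → ℕ) (G : ∀ n, SimpleGraph (Fin (N n))),
      (∀ n, (G n).Connected) ∧
      (∀ n v, deg (G n) v ≤ D) ∧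
      Tendsto N atTop atTop ∧
      -- a partition of the vertices into singletons and pairs, encoded as the fibers of `p n`
      ∃ (k : ℕ → ℕ) (p : ∀ n, Fin (N n) → Fin (k n)),
        (∀ n, Function.Surjective (p n)) ∧
        (∀ n i, Nat.card {a // p n a = i} = 1 ∨ Nat.card {a // p n a = i} = 2) ∧
        ∃ c C : ℝ, 0 < c ∧ 0 < C ∧ ∀ n,
          c * Real.log (N n) * (tmixG (G n) (1/4) : ℝ) ≤
            (mixTime (lumpMat (walkMat (G n)) (degSta (G n)) (p n))
              (lumpSta (degSta (G n)) (p n)) (1/4) : ℝ) ∧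
          (mixTime (lumpMat (walkMat (G n)) (degSta (G n)) (p n))
              (lumpSta (degSta (G n)) (p n)) (1/4) : ℝ) ≤
            C * Real.log (N n) * (tmixG (G n) (1/4) : ℝ) := by
  have h100 : ∀ n, 100 ≤ n + 100 := fun n => by omega
  choose G hG hD k p hs hc h using fun n => Lamp.exists_graph (h100 n)
  refine ⟨6, fun n => Fintype.card (Lamp.Vert (n + 100)), G, hG, hD, ?_, k, p, hs, hc,
    1 / 69264, 3, by norm_num, by norm_num, h⟩
  refine tendsto_atTop_mono (fun n => ?_) tendsto_id
  calc n ≤ 2 * (n + 100) := by omega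
    _ ≤ 2 ^ (2 * (n + 100)) := Nat.lt_two_pow_self.le
    _ ≤ _ := Lamp.le_card_vert _

end
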